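/- For real $\alpha$ with $|\alpha|>1$ and $\beta\in\mathbb Z$ write $S(\beta)=(\alpha^2+\beta^2)^{1/2}$. A family $\theta=(\theta(t,\beta))_{t\ge 0,\,\beta\in\mathbb Z}$ of complex numbers is a solution of the critical QG mode system with viscosity $\nu>0$ at wave number $\alpha$ if each coordinate $t\mapsto\theta(t,\beta)$ is differentiable on $[0,\infty)$ (from the right at $t=0$) and, for all $t\ge 0$ and $\beta\in\mathbb Z$, $$\frac{d}{dt}\theta(t,\beta)=-\nu S(\beta)\theta(t,\beta)-\frac{i\alpha e^{-\nu t}}{2}\Big[\big(1-S(\beta-1)^{-1}\big)\theta(t,\beta-1)+\big(1-S(\beta+1)^{-1}\big)\theta(t,\beta+1)\Big].$$ It is rapidly decaying if $\sup_{0\le t\le T}\sum_{\beta}(1+\beta^2)^k|\theta(t,\beta)|^2<\infty$ for every $k\in\mathbb N$ and $T>0$. With $u(t,\beta)=(1-S(\beta)^{-1})\theta(t,\beta)$ put $$E_0(t)=\sum_\beta\frac{S(\beta)-1}{S(\beta)}|\theta(t,\beta)|^2,\qquad E_1(t)=\sum_\beta\beta^2\,\frac{S(\beta)-1}{S(\beta)}|\theta(t,\beta)|^2,$$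 $$\mathcal E_1(t)=-\frac{\operatorname{sgn}(\alpha)}{2}\sum_\beta\beta\,\operatorname{Im}\Big(\big(u(t,\beta-1)-u(t,\beta+1)\big)\overline{u(t,\beta)}\Big),$$ $$\mathcal E_2(t)=E_0(t)-\frac14\sum_\beta\frac{S(\beta)-1}{S(\beta)}\,|u(t,\beta-1)+u(t,\beta+1)|^2 .$$ Let $c_0>1$. There exist constants $c,K>0$ depending only on $c_0$ such that the following holds for every real $\alpha$ with $|\alpha|\ge c_0$. Put $$a_1=\frac{|\alpha|^{-1}}{4cK^2},\qquad a_2=\frac{|\alpha|^{-1/2}}{8cK^3},\qquad a_3=\frac{1}{8cK^4}.$$ Then for every $\nu$ with $0<\nu\le 1$ and every rapidly decaying solution $\theta$ of the critical QG mode system with viscosity $\nu$ at wave number $\alpha$, the functional $$\Phi(t)=E_0(t)+a_1\nu^2t^2E_1(t)+a_2\nu^2t^3\mathcal E_1(t)+a_3\nu^2t^4\mathcal E_2(t)$$ is differentiable on $[0,\nu^{-3/5}]$ (from the right at $t=0$) and satisfies, for all $0\le t\le\nu^{-3/5}$, $$\Phi(t)\ge E_0(t)\qquad\text{and}\qquad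 \Phi'(t)\le -a_3\,\nu^3t^4E_0(t).$$ -/

import Mathlib

/-- `S(β) = (α² + β²)^{1/2}`. -/
noncomputable def Sv (α : ℝ) (β : ℤ) : ℝ := Real.sqrt (α ^ 2 + (β : ℝ) ^ 2)

/-- A family `θ` is rapidly decaying if for every `k ∈ ℕ` and `T > 0`,
`sup_{0 ≤ t ≤ T} Σ_β (1+β²)^k |θ(t,β)|² < ∞`. Only times `t ≥ 0` matter. -/
def RapidlyDecaying (θ : ℝ → ℤ → ℂ) : Prop :=
  ∀ k : ℕ, ∀ T : ℝ, 0 < T → ∃ M : ℝ, ∀ t : ℝ, 0 ≤ t → t ≤ T →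
    Summable (fun β : ℤ => (1 + (β : ℝ) ^ 2) ^ k * ‖θ t β‖ ^ 2) ∧
    (∑' β : ℤ, (1 + (β : ℝ) ^ 2) ^ k * ‖θ t β‖ ^ 2) ≤ M

/-- The critical QG mode system on `[0, ∞)` with viscosity `ν` at wave number `α`:
`d/dt θ(t,β) = −ν S(β) θ(t,β) − (i α e^{−νt}/2)[(1 − S(β−1)⁻¹) θ(t,β−1) + (1 − S(β+1)⁻¹) θ(t,β+1)]`
for all `t ≥ 0` and `β ∈ ℤ`. The derivative is taken within `[0, ∞)`, so it is the right
derivative at `t = 0` and the ordinary one for `t > 0`. -/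
def CriticalQG (α ν : ℝ) (θ : ℝ → ℤ → ℂ) : Prop :=
  ∀ t : ℝ, 0 ≤ t → ∀ β : ℤ,
    HasDerivWithinAt (fun s => θ s β)
      (-((ν * Sv α β : ℝ) : ℂ) * θ t β
        - Complex.I * (α : ℂ) * ((Real.exp (-(ν * t)) : ℝ) : ℂ) / 2 *
          ((1 - ((Sv α (β - 1) : ℝ) : ℂ)⁻¹) * θ t (β - 1)
            + (1 - ((Sv α (β + 1) : ℝ) : ℂ)⁻¹) * θ t (β + 1))) (Set.Ici 0) t

/-- `u(t,β) = (1 − S(β)⁻¹) θ(t,β)`. -/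
noncomputable def uth (α : ℝ) (θ : ℝ → ℤ → ℂ) (t : ℝ) (β : ℤ) : ℂ :=
  (1 - ((Sv α β : ℝ) : ℂ)⁻¹) * θ t β

/-- `E₀(t) = Σ_β ((S(β)−1)/S(β)) |θ(t,β)|²`. -/
noncomputable def E0 (α : ℝ) (θ : ℝ → ℤ → ℂ) (t : ℝ) : ℝ :=
  ∑' β : ℤ, ((Sv α β - 1) / Sv α β) * ‖θ t β‖ ^ 2

/-- `E₁(t) = Σ_β β² ((S(β)−1)/S(β)) |θ(t,β)|²`. -/
noncomputable def E1 (α : ℝ) (θ : ℝ → ℤ → ℂ) (t : ℝ) : ℝ :=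
  ∑' β : ℤ, (β : ℝ) ^ 2 * ((Sv α β - 1) / Sv α β) * ‖θ t β‖ ^ 2

/-- `ℰ₁(t) = −sgn(α) (1/2) Σ_β β Im((u(t,β−1) − u(t,β+1)) conj(u(t,β)))`. -/
noncomputable def mE1 (α : ℝ) (θ : ℝ → ℤ → ℂ) (t : ℝ) : ℝ :=
  -Real.sign α * ((1 / 2) * ∑' β : ℤ,
    (β : ℝ) * ((uth α θ t (β - 1) - uth α θ t (β + 1)) * (starRingEnd ℂ) (uth α θ t β)).im)

/-- `ℰ₂(t) = E₀(t) − (1/4) Σ_β ((S(β)−1)/S(β)) |u(t,β−1) + u(t,β+1)|²`. -/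
noncomputable def mE2 (α : ℝ) (θ : ℝ → ℤ → ℂ) (t : ℝ) : ℝ :=
  E0 α θ t - (1 / 4) * ∑' β : ℤ,
    ((Sv α β - 1) / Sv α β) * ‖uth α θ t (β - 1) + uth α θ t (β + 1)‖ ^ 2

/-- `Φ(t) = E₀(t) + a₁ ν² t² E₁(t) + a₂ ν² t³ ℰ₁(t) + a₃ ν² t⁴ ℰ₂(t)`. -/
noncomputable def PhiQG (a₁ a₂ a₃ α ν : ℝ) (θ : ℝ → ℤ → ℂ) (t : ℝ) : ℝ :=
  E0 α θ t + a₁ * ν ^ 2 * t ^ 2 * E1 α θ t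
    + a₂ * ν ^ 2 * t ^ 3 * mE1 α θ t + a₃ * ν ^ 2 * t ^ 4 * mE2 α θ t

/-! ### Rapidly decaying families of sequences -/

/-- The family `f t` decays faster than any power of the index, uniformly for `t ∈ s`. -/
def RapidOn (s : Set ℝ) (f : ℝ → ℤ → ℝ) : Prop :=
  ∀ k : ℕ, ∃ M : ℝ, ∀ t ∈ s, ∀ β : ℤ, (1 + (β : ℝ) ^ 2) ^ k * |f t β| ≤ M

/-- The sequence `f` decays faster than any power of the index. -/
abbrev Rapid (f : ℤ → ℝ) : Prop := RapidOn Set.univ (fun _ => f)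

/-- The sequence `c` grows at most polynomially. -/
def PolyBounded (c : ℤ → ℝ) : Prop :=
  ∃ (j : ℕ) (C : ℝ), 0 ≤ C ∧ ∀ β : ℤ, |c β| ≤ C * (1 + (β : ℝ) ^ 2) ^ j

namespace PolyBounded

variable {c d : ℤ → ℝ}

lemma of_bounded {C : ℝ} (h : ∀ β, |c β| ≤ C) : PolyBounded c :=
  ⟨0, C, (abs_nonneg _).trans (h 0), fun β => by simpa using h β⟩

lemma const (C : ℝ) : PolyBounded (fun _ => C) := of_bounded fun _ => le_rfl

lemma mono (hd : PolyBounded d) (h : ∀ β, |c β| ≤ |d β|) : PolyBounded c := by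
  obtain ⟨j, C, hC, hj⟩ := hd
  exact ⟨j, C, hC, fun β => (h β).trans (hj β)⟩

lemma cast : PolyBounded (fun β => (β : ℝ)) := by
  refine ⟨1, 1, zero_le_one, fun β => ?_⟩
  rw [abs_le]; constructor <;> nlinarith [sq_nonneg ((β : ℝ) + 1), sq_nonneg ((β : ℝ) - 1)]

lemma mul (hc : PolyBounded c) (hd : PolyBounded d) : PolyBounded (fun β => c β * d β) := by
  obtain ⟨i, C, hC, hi⟩ := hc
  obtain ⟨j, D, hD, hj⟩ := hd
  refine ⟨i + j, C * D, by positivity, fun β => ?_⟩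
  rw [abs_mul, pow_add]
  calc |c β| * |d β| ≤ (C * (1 + (β : ℝ) ^ 2) ^ i) * (D * (1 + (β : ℝ) ^ 2) ^ j) :=
        mul_le_mul (hi β) (hj β) (abs_nonneg _) (by positivity)
    _ = _ := by ring

lemma add (hc : PolyBounded c) (hd : PolyBounded d) : PolyBounded (fun β => c β + d β) := by
  obtain ⟨i, C, hC, hi⟩ := hc
  obtain ⟨j, D, hD, hj⟩ := hd
  refine ⟨i + j, C + D, by positivity, fun β => ?_⟩
  have h1 : (1 : ℝ) ≤ 1 + (β : ℝ) ^ 2 := by nlinarith [sq_nonneg (β : ℝ)]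
  have h2 : (1 + (β : ℝ) ^ 2) ^ i ≤ (1 + (β : ℝ) ^ 2) ^ (i + j) :=
    pow_le_pow_right₀ h1 (Nat.le_add_right _ _)
  have h3 : (1 + (β : ℝ) ^ 2) ^ j ≤ (1 + (β : ℝ) ^ 2) ^ (i + j) :=
    pow_le_pow_right₀ h1 (Nat.le_add_left _ _)
  calc |c β + d β| ≤ |c β| + |d β| := abs_add_le _ _
    _ ≤ C * (1 + (β : ℝ) ^ 2) ^ i + D * (1 + (β : ℝ) ^ 2) ^ j := add_le_add (hi β) (hj β)
    _ ≤ C * (1 + (β : ℝ) ^ 2) ^ (i + j) + D * (1 + (β : ℝ) ^ 2) ^ (i + j) := by gcongr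
    _ = _ := by ring

lemma neg (hc : PolyBounded c) : PolyBounded (fun β => -c β) := hc.mono fun β => by simp

lemma sub (hc : PolyBounded c) (hd : PolyBounded d) : PolyBounded (fun β => c β - d β) := by
  simpa only [sub_eq_add_neg] using hc.add hd.neg

lemma shift (hc : PolyBounded c) (i : ℤ) : PolyBounded (fun β => c (β + i)) := by
  obtain ⟨j, C, hC, hj⟩ := hc
  refine ⟨j, C * (2 * (1 + (i : ℝ) ^ 2)) ^ j, by positivity, fun β => (hj _).trans ?_⟩
  rw [mul_assoc, ← mul_pow]
  gcongr
  push_cast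
  nlinarith [sq_nonneg ((β : ℝ) - i), sq_nonneg ((β : ℝ) * i)]

lemma next (hc : PolyBounded c) : PolyBounded (fun β => c (β + 1)) := hc.shift 1

lemma prev (hc : PolyBounded c) : PolyBounded (fun β => c (β - 1)) := hc.shift (-1)

end PolyBounded

namespace RapidOn

variable {s : Set ℝ} {f g : ℝ → ℤ → ℝ} {c : ℤ → ℝ}

lemma at_time (hf : RapidOn s f) {t : ℝ} (ht : t ∈ s) : Rapid (f t) := fun k => by
  obtain ⟨M, hM⟩ := hf k
  exact ⟨M, fun _ _ β => hM t ht β⟩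

lemma add (hf : RapidOn s f) (hg : RapidOn s g) : RapidOn s (fun t β => f t β + g t β) := by
  intro k
  obtain ⟨M, hM⟩ := hf k
  obtain ⟨N, hN⟩ := hg k
  refine ⟨M + N, fun t ht β => ?_⟩
  calc (1 + (β : ℝ) ^ 2) ^ k * |f t β + g t β|
      ≤ (1 + (β : ℝ) ^ 2) ^ k * (|f t β| + |g t β|) := by gcongr; exact abs_add_le _ _
    _ ≤ M + N := by rw [mul_add]; exact add_le_add (hM t ht β) (hN t ht β)

lemma mul_time {a : ℝ → ℝ} {A : ℝ} (ha : ∀ t ∈ s, |a t| ≤ A) (hf : RapidOn s f) :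
    RapidOn s (fun t β => a t * f t β) := by
  intro k
  obtain ⟨M, hM⟩ := hf k
  refine ⟨A * M, fun t ht β => ?_⟩
  have h0 : 0 ≤ A := (abs_nonneg _).trans (ha t ht)
  calc (1 + (β : ℝ) ^ 2) ^ k * |a t * f t β|
      = |a t| * ((1 + (β : ℝ) ^ 2) ^ k * |f t β|) := by rw [abs_mul]; ring
    _ ≤ A * M := mul_le_mul (ha t ht) (hM t ht β) (by positivity) h0

lemma neg (hf : RapidOn s f) : RapidOn s (fun t β => -f t β) := fun k => by
  simpa only [abs_neg] using hf k

lemma sub (hf : RapidOn s f) (hg : RapidOn s g) : RapidOn s (fun t β => f t β - g t β) := by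
  simpa only [sub_eq_add_neg] using hf.add hg.neg

lemma weight (hc : PolyBounded c) (hf : RapidOn s f) : RapidOn s (fun t β => c β * f t β) := by
  intro k
  obtain ⟨j, C, hC, hj⟩ := hc
  obtain ⟨M, hM⟩ := hf (k + j)
  refine ⟨C * M, fun t ht β => ?_⟩
  calc (1 + (β : ℝ) ^ 2) ^ k * |c β * f t β|
      = |c β| * ((1 + (β : ℝ) ^ 2) ^ k * |f t β|) := by rw [abs_mul]; ring
    _ ≤ (C * (1 + (β : ℝ) ^ 2) ^ j) * ((1 + (β : ℝ) ^ 2) ^ k * |f t β|) := by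
        gcongr; exact hj β
    _ = C * ((1 + (β : ℝ) ^ 2) ^ (k + j) * |f t β|) := by rw [pow_add]; ring
    _ ≤ C * M := by gcongr; exact hM t ht β

lemma mul (hf : RapidOn s f) (hg : RapidOn s g) : RapidOn s (fun t β => f t β * g t β) := by
  intro k
  obtain ⟨M, hM⟩ := hf 0
  obtain ⟨N, hN⟩ := hg k
  refine ⟨M * N, fun t ht β => ?_⟩
  have h1 : |f t β| ≤ M := by simpa using hM t ht β
  calc (1 + (β : ℝ) ^ 2) ^ k * |f t β * g t β|
      = |f t β| * ((1 + (β : ℝ) ^ 2) ^ k * |g t β|) := by rw [abs_mul]; ring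
    _ ≤ M * N := mul_le_mul h1 (hN t ht β) (by positivity) ((abs_nonneg _).trans h1)

lemma sq (hf : RapidOn s f) : RapidOn s (fun t β => f t β ^ 2) := by
  simpa only [_root_.sq] using hf.mul hf

lemma shift (hf : RapidOn s f) (i : ℤ) : RapidOn s (fun t β => f t (β + i)) := by
  intro k
  obtain ⟨M, hM⟩ := hf k
  refine ⟨(2 * (1 + (i : ℝ) ^ 2)) ^ k * M, fun t ht β => ?_⟩
  have h := hM t ht (β + i)
  calc (1 + (β : ℝ) ^ 2) ^ k * |f t (β + i)|
      ≤ ((2 * (1 + (i : ℝ) ^ 2)) * (1 + ((β + i : ℤ) : ℝ) ^ 2)) ^ k * |f t (β + i)| := by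
        gcongr
        push_cast
        nlinarith [sq_nonneg ((β : ℝ) + 2 * i), sq_nonneg (((β : ℝ) + i) * i)]
    _ = (2 * (1 + (i : ℝ) ^ 2)) ^ k
          * ((1 + ((β + i : ℤ) : ℝ) ^ 2) ^ k * |f t (β + i)|) := by rw [mul_pow]; ring
    _ ≤ _ := by gcongr

lemma next (hf : RapidOn s f) : RapidOn s (fun t β => f t (β + 1)) := hf.shift 1

lemma prev (hf : RapidOn s f) : RapidOn s (fun t β => f t (β - 1)) := hf.shift (-1)

/-- A single summable sequence dominates a rapidly decaying family. -/
lemma exists_bound (hf : RapidOn s f) :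
    ∃ b : ℤ → ℝ, Summable b ∧ ∀ t ∈ s, ∀ β, |f t β| ≤ b β := by
  obtain ⟨M, hM⟩ := hf 1
  refine ⟨fun β => M * (1 + (β : ℝ) ^ 2)⁻¹, Summable.mul_left _ ?_, fun t ht β => ?_⟩
  · refine Summable.of_norm_bounded_eventually
      (Real.summable_one_div_int_pow.mpr (one_lt_two : 1 < 2)) ?_
    filter_upwards [(Set.finite_singleton (0 : ℤ)).compl_mem_cofinite] with β hβ
    have h0 : (β : ℝ) ≠ 0 := by exact_mod_cast hβ
    have h1 : 0 < (β : ℝ) ^ 2 := by positivity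
    rw [Real.norm_of_nonneg (by positivity), one_div]
    exact inv_anti₀ h1 (by linarith)
  · have h := hM t ht β
    have h1 : 0 < 1 + (β : ℝ) ^ 2 := by positivity
    change |f t β| ≤ M * (1 + (β : ℝ) ^ 2)⁻¹
    rw [← div_eq_mul_inv, le_div_iff₀ h1]
    linarith

end RapidOn

lemma Rapid.summable {f : ℤ → ℝ} (hf : Rapid f) : Summable f := by
  obtain ⟨b, hb, h⟩ := RapidOn.exists_bound hf
  exact Summable.of_norm_bounded hb fun β => h 0 trivial β

/-! ### Summation by parts over `ℤ` -/

lemma tsum_shift_sub_eq_zero {H : ℤ → ℝ} (hH : Summable H) :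
    Summable (fun β => H (β + 1) - H β) ∧ ∑' β, (H (β + 1) - H β) = 0 := by
  have h1 : Summable (fun β : ℤ => H (β + 1)) :=
    (Equiv.addRight (1 : ℤ)).summable_iff.mpr hH
  refine ⟨h1.sub hH, ?_⟩
  rw [h1.tsum_sub hH, sub_eq_zero]
  exact (Equiv.addRight (1 : ℤ)).tsum_eq H

lemma tsum_eq_of_telescope {F G H : ℤ → ℝ} (hG : Rapid G) (hH : Rapid H)
    (h : ∀ β, F β = G β + (H (β + 1) - H β)) : ∑' β, F β = ∑' β, G β := by
  obtain ⟨h1, h2⟩ := tsum_shift_sub_eq_zero hH.summable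
  rw [tsum_congr h, hG.summable.tsum_add h1, h2, add_zero]

lemma tsum_le_of_telescope {F G H : ℤ → ℝ} (hF : Rapid F) (hG : Rapid G) (hH : Rapid H)
    (h : ∀ β, F β ≤ G β + (H (β + 1) - H β)) : ∑' β, F β ≤ ∑' β, G β := by
  obtain ⟨h1, h2⟩ := tsum_shift_sub_eq_zero hH.summable
  have h3 := hF.summable.tsum_le_tsum h (hG.summable.add h1)
  rwa [hG.summable.tsum_add h1, h2, add_zero] at h3

lemma Rapid.tsum_le {F G : ℤ → ℝ} (hF : Rapid F) (hG : Rapid G) (h : ∀ β, F β ≤ G β) :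
    ∑' β, F β ≤ ∑' β, G β := hF.summable.tsum_le_tsum h hG.summable

/-! ### Termwise differentiation -/

lemma hasDerivWithinAt_tsum_of_convex {s : Set ℝ} (hs : Convex ℝ s) {f f' : ℝ → ℤ → ℝ}
    (hf : RapidOn s f) (hf' : RapidOn s f')
    (h : ∀ t ∈ s, ∀ β, HasDerivWithinAt (fun τ => f τ β) (f' t β) s t) {t : ℝ} (ht : t ∈ s) :
    HasDerivWithinAt (fun τ => ∑' β, f τ β) (∑' β, f' t β) s t := by
  obtain ⟨b, hb, hbd⟩ := hf'.exists_bound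
  rw [hasDerivWithinAt_iff_tendsto_slope]
  have key : Filter.Tendsto (fun τ => ∑' β, slope (fun r => f r β) t τ)
      (nhdsWithin t (s \ {t})) (nhds (∑' β, f' t β)) := by
    refine tendsto_tsum_of_dominated_convergence hb
      (fun β => hasDerivWithinAt_iff_tendsto_slope.mp (h t ht β)) ?_
    filter_upwards [self_mem_nhdsWithin] with τ hτ β
    have h1 := hs.norm_image_sub_le_of_norm_hasDerivWithin_le (f := fun r => f r β)
      (f' := fun r => f' r β) (C := b β) (fun r hr => h r hr β) (fun r hr => hbd r hr β) ht hτ.1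
    have h2 : 0 < ‖τ - t‖ := norm_pos_iff.mpr (sub_ne_zero.mpr hτ.2)
    rw [slope_def_field, norm_div, div_le_iff₀ h2]
    exact h1
  refine key.congr' ?_
  filter_upwards [self_mem_nhdsWithin] with τ hτ
  rw [slope_def_field, ← (hf.at_time hτ.1).summable.tsum_sub (hf.at_time ht).summable,
    ← tsum_div_const]
  exact tsum_congr fun β => slope_def_field _ _ _

/-- The family `f` is differentiable in time and, like its time derivative, rapidly decaying. -/
structure RapidC1 (s : Set ℝ) (f f' : ℝ → ℤ → ℝ) : Prop where
  rapid : RapidOn s f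
  rapid' : RapidOn s f'
  deriv : ∀ t ∈ s, ∀ β, HasDerivWithinAt (fun τ => f τ β) (f' t β) s t

namespace RapidC1

variable {s : Set ℝ} {f f' g g' : ℝ → ℤ → ℝ} {c : ℤ → ℝ}

lemma add (hf : RapidC1 s f f') (hg : RapidC1 s g g') :
    RapidC1 s (fun t β => f t β + g t β) (fun t β => f' t β + g' t β) :=
  ⟨hf.rapid.add hg.rapid, hf.rapid'.add hg.rapid',
    fun t ht β => (hf.deriv t ht β).fun_add (hg.deriv t ht β)⟩

lemma sub (hf : RapidC1 s f f') (hg : RapidC1 s g g') :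
    RapidC1 s (fun t β => f t β - g t β) (fun t β => f' t β - g' t β) :=
  ⟨hf.rapid.sub hg.rapid, hf.rapid'.sub hg.rapid',
    fun t ht β => (hf.deriv t ht β).fun_sub (hg.deriv t ht β)⟩

lemma mul (hf : RapidC1 s f f') (hg : RapidC1 s g g') :
    RapidC1 s (fun t β => f t β * g t β) (fun t β => f' t β * g t β + f t β * g' t β) :=
  ⟨hf.rapid.mul hg.rapid, (hf.rapid'.mul hg.rapid).add (hf.rapid.mul hg.rapid'),
    fun t ht β => (hf.deriv t ht β).fun_mul (hg.deriv t ht β)⟩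

lemma sq (hf : RapidC1 s f f') :
    RapidC1 s (fun t β => f t β ^ 2) (fun t β => 2 * f t β * f' t β) := by
  have h := hf.mul hf
  simp only [← _root_.sq] at h
  convert h using 3
  ring

lemma weight (hc : PolyBounded c) (hf : RapidC1 s f f') :
    RapidC1 s (fun t β => c β * f t β) (fun t β => c β * f' t β) :=
  ⟨hf.rapid.weight hc, hf.rapid'.weight hc, fun t ht β => (hf.deriv t ht β).const_mul _⟩

lemma next (hf : RapidC1 s f f') :
    RapidC1 s (fun t β => f t (β + 1)) (fun t β => f' t (β + 1)) :=
  ⟨hf.rapid.next, hf.rapid'.next, fun t ht β => hf.deriv t ht (β + 1)⟩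

lemma prev (hf : RapidC1 s f f') :
    RapidC1 s (fun t β => f t (β - 1)) (fun t β => f' t (β - 1)) :=
  ⟨hf.rapid.prev, hf.rapid'.prev, fun t ht β => hf.deriv t ht (β - 1)⟩

lemma hasDerivWithinAt_tsum (hs : Convex ℝ s) (hf : RapidC1 s f f') {t : ℝ} (ht : t ∈ s) :
    HasDerivWithinAt (fun τ => ∑' β, f τ β) (∑' β, f' t β) s t :=
  hasDerivWithinAt_tsum_of_convex hs hf.rapid hf.rapid' hf.deriv ht

end RapidC1

/-! ### The weights `S` and `1 - 1/S` -/

/-- The multiplier `1 - S(β)⁻¹`. -/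
noncomputable def mw (α : ℝ) (β : ℤ) : ℝ := 1 - (Sv α β)⁻¹

section Weights

variable {α : ℝ}

lemma Sv_sq (α : ℝ) (β : ℤ) : Sv α β ^ 2 = α ^ 2 + (β : ℝ) ^ 2 :=
  Real.sq_sqrt (by positivity)

lemma Sv_nonneg (α : ℝ) (β : ℤ) : 0 ≤ Sv α β := Real.sqrt_nonneg _

lemma abs_le_Sv (α : ℝ) (β : ℤ) : |α| ≤ Sv α β :=
  Real.abs_le_sqrt (by nlinarith [sq_nonneg (β : ℝ)])

lemma abs_index_le_Sv (α : ℝ) (β : ℤ) : |(β : ℝ)| ≤ Sv α β :=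
  Real.abs_le_sqrt (by nlinarith [sq_nonneg α])

lemma one_lt_Sv (hα : 1 < |α|) (β : ℤ) : 1 < Sv α β := hα.trans_le (abs_le_Sv α β)

lemma Sv_pos (hα : 1 < |α|) (β : ℤ) : 0 < Sv α β := zero_lt_one.trans (one_lt_Sv hα β)

lemma Sv_next_sq (α : ℝ) (β : ℤ) : Sv α (β + 1) ^ 2 = Sv α β ^ 2 + 2 * β + 1 := by
  rw [Sv_sq, Sv_sq]; push_cast; ring

lemma Sv_prev_sq (α : ℝ) (β : ℤ) : Sv α (β - 1) ^ 2 = Sv α β ^ 2 - 2 * β + 1 := by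
  rw [Sv_sq, Sv_sq]; push_cast; ring

lemma Sv_next_le (α : ℝ) (β : ℤ) : Sv α (β + 1) ≤ Sv α β + 1 := by
  have h := abs_le.mp (abs_index_le_Sv α β)
  have h0 := Sv_nonneg α β
  refine abs_le_of_sq_le_sq' ?_ (by linarith) |>.2
  rw [Sv_next_sq]; nlinarith

lemma Sv_prev_le (α : ℝ) (β : ℤ) : Sv α (β - 1) ≤ Sv α β + 1 := by
  have h := abs_le.mp (abs_index_le_Sv α β)
  have h0 := Sv_nonneg α β
  refine abs_le_of_sq_le_sq' ?_ (by linarith) |>.2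
  rw [Sv_prev_sq]; nlinarith

lemma Sv_le_next (α : ℝ) (β : ℤ) : Sv α β ≤ Sv α (β + 1) + 1 := by
  simpa using Sv_prev_le α (β + 1)

lemma Sv_le_prev (α : ℝ) (β : ℤ) : Sv α β ≤ Sv α (β - 1) + 1 := by
  simpa using Sv_next_le α (β - 1)

lemma Sv_convex (α : ℝ) (β : ℤ) : 2 * Sv α β ≤ Sv α (β + 1) + Sv α (β - 1) := by
  have h1 := Sv_next_sq α β
  have h2 := Sv_prev_sq α β
  have h3 := Sv_nonneg α (β + 1)
  have h4 := Sv_nonneg α (β - 1)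
  have h5 := Sv_sq α β
  have h6 : Sv α β ^ 2 - 1 ≤ Sv α (β + 1) * Sv α (β - 1) := by
    refine abs_le_of_sq_le_sq' ?_ (by positivity) |>.2
    rw [mul_pow, h1, h2]; nlinarith [sq_nonneg α]
  refine abs_le_of_sq_le_sq' ?_ (by positivity) |>.2
  nlinarith

lemma Sv_second_difference_le (hα : 1 < |α|) (β : ℤ) :
    Sv α (β + 1) + Sv α (β - 1) - 2 * Sv α β ≤ (Sv α β)⁻¹ := by
  have h0 := Sv_pos hα β
  have h1 := Sv_next_sq α β
  have h2 := Sv_prev_sq α β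
  rw [← one_div, le_div_iff₀ h0]
  nlinarith [sq_nonneg (Sv α (β + 1) - Sv α β), sq_nonneg (Sv α (β - 1) - Sv α β)]

lemma Sv_next_le_two_mul (hα : 1 < |α|) (β : ℤ) : Sv α (β + 1) ≤ 2 * Sv α β := by
  linarith [Sv_next_le α β, one_lt_Sv hα β]

lemma Sv_prev_le_two_mul (hα : 1 < |α|) (β : ℤ) : Sv α (β - 1) ≤ 2 * Sv α β := by
  linarith [Sv_prev_le α β, one_lt_Sv hα β]

lemma inv_Sv_next_le (hα : 1 < |α|) (β : ℤ) : (Sv α (β + 1))⁻¹ ≤ 2 * (Sv α β)⁻¹ := by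
  have h0 := Sv_pos hα β
  have h1 := Sv_pos hα (β + 1)
  rw [← div_eq_mul_inv, le_div_iff₀ h0, inv_mul_le_iff₀ h1]
  linarith [Sv_le_next α β, one_lt_Sv hα (β + 1)]

lemma inv_Sv_prev_le (hα : 1 < |α|) (β : ℤ) : (Sv α (β - 1))⁻¹ ≤ 2 * (Sv α β)⁻¹ := by
  have h0 := Sv_pos hα β
  have h1 := Sv_pos hα (β - 1)
  rw [← div_eq_mul_inv, le_div_iff₀ h0, inv_mul_le_iff₀ h1]
  linarith [Sv_le_prev α β, one_lt_Sv hα (β - 1)]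

lemma mw_pos (hα : 1 < |α|) (β : ℤ) : 0 < mw α β :=
  sub_pos.mpr (inv_lt_one_of_one_lt₀ (one_lt_Sv hα β))

lemma mw_le_one (α : ℝ) (β : ℤ) : mw α β ≤ 1 := by
  have := inv_nonneg.mpr (Sv_nonneg α β)
  unfold mw; linarith

lemma le_mw {c₀ : ℝ} (hc₀ : 1 < c₀) (hα : c₀ ≤ |α|) (β : ℤ) : 1 - c₀⁻¹ ≤ mw α β := by
  have := inv_anti₀ (by linarith) (hα.trans (abs_le_Sv α β))
  unfold mw; linarith

lemma one_le_inv_mw (hα : 1 < |α|) (β : ℤ) : 1 ≤ (mw α β)⁻¹ :=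
  (one_le_inv₀ (mw_pos hα β)).mpr (mw_le_one α β)

lemma Sv_mul_mw (hα : 1 < |α|) (β : ℤ) : Sv α β * mw α β = Sv α β - 1 := by
  have := (Sv_pos hα β).ne'
  unfold mw; field_simp

lemma inv_mw_eq (hα : 1 < |α|) (β : ℤ) :
    (mw α β)⁻¹ = 1 + (Sv α β)⁻¹ * (mw α β)⁻¹ := by
  have h1 := (mw_pos hα β).ne'
  have h2 : mw α β + (Sv α β)⁻¹ = 1 := by unfold mw; ring
  field_simp
  rw [one_div, h2]

lemma mul_mw_next_sub_prev (hα : 1 < |α|) (β : ℤ) :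
    (β : ℝ) ^ 2 * ((Sv α β)⁻¹) ^ 3 / 4 ≤ β * (mw α (β + 1) - mw α (β - 1)) := by
  have h0 := Sv_pos hα β
  have h1 := Sv_pos hα (β + 1)
  have h2 := Sv_pos hα (β - 1)
  have h3 := Sv_next_le_two_mul hα β
  have h4 := Sv_prev_le_two_mul hα β
  have key : (β : ℝ) * (mw α (β + 1) - mw α (β - 1)) =
      4 * (β : ℝ) ^ 2 / (Sv α (β + 1) * Sv α (β - 1) * (Sv α (β + 1) + Sv α (β - 1))) := by
    unfold mw
    have h5 := Sv_next_sq α β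
    have h6 := Sv_prev_sq α β
    field_simp
    linear_combination (β : ℝ) * h5 - (β : ℝ) * h6
  have h7 : Sv α (β + 1) * Sv α (β - 1) * (Sv α (β + 1) + Sv α (β - 1)) ≤ 16 * Sv α β ^ 3 := by
    calc _ ≤ (2 * Sv α β) * (2 * Sv α β) * (2 * Sv α β + 2 * Sv α β) := by gcongr
      _ = _ := by ring
  rw [key]
  calc (β : ℝ) ^ 2 * ((Sv α β)⁻¹) ^ 3 / 4 = 4 * (β : ℝ) ^ 2 / (16 * Sv α β ^ 3) := by
        field_simp; norm_num
    _ ≤ _ := by gcongr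

lemma polyBounded_Sv (α : ℝ) : PolyBounded (Sv α) := by
  refine ⟨1, |α| + 1, by positivity, fun β => ?_⟩
  rw [abs_of_nonneg (Sv_nonneg α β)]
  refine abs_le_of_sq_le_sq' ?_ (by positivity) |>.2
  rw [Sv_sq, ← sq_abs α]
  have h1 := abs_nonneg α
  nlinarith [sq_nonneg (β : ℝ), mul_nonneg h1 (sq_nonneg (β : ℝ)), sq_nonneg (|α| * β),
    sq_nonneg (|α| * (β : ℝ) ^ 2), sq_nonneg ((β : ℝ) ^ 2),
    mul_nonneg h1 (sq_nonneg ((β : ℝ) ^ 2))]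

lemma polyBounded_inv_Sv (hα : 1 < |α|) : PolyBounded (fun β => (Sv α β)⁻¹) :=
  PolyBounded.of_bounded (C := 1) fun β => by
    rw [abs_of_pos (inv_pos.mpr (Sv_pos hα β))]
    exact (inv_lt_one_of_one_lt₀ (one_lt_Sv hα β)).le

lemma polyBounded_mw (hα : 1 < |α|) : PolyBounded (mw α) :=
  (PolyBounded.const 1).sub (polyBounded_inv_Sv hα)

lemma polyBounded_inv_mw (hα : 1 < |α|) : PolyBounded (fun β => (mw α β)⁻¹) :=
  PolyBounded.of_bounded (C := (1 - |α|⁻¹)⁻¹) fun β => by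
    rw [abs_of_pos (inv_pos.mpr (mw_pos hα β))]
    exact inv_anti₀ (sub_pos.mpr (inv_lt_one_of_one_lt₀ hα)) (le_mw hα le_rfl β)

end Weights

/-! ### Weighted energies of a pair of real sequences -/

/-- The neighbour sum `x(β-1) + x(β+1)`. -/
def nbrSum (x : ℤ → ℝ) (β : ℤ) : ℝ := x (β - 1) + x (β + 1)

/-- The centred half difference `(x(β-1) - x(β+1))/2`. -/
noncomputable def halfDiff (x : ℤ → ℝ) (β : ℤ) : ℝ := (x (β - 1) - x (β + 1)) / 2

/-- The energy `Σ c(β) (x(β)² + y(β)²)`. -/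
noncomputable def wEnergy (c x y : ℤ → ℝ) : ℝ := ∑' β, c β * (x β ^ 2 + y β ^ 2)

/-- The Wronskian `y(β-1) x(β) - x(β-1) y(β)`. -/
def wronsk (x y : ℤ → ℝ) (β : ℤ) : ℝ := y (β - 1) * x β - x (β - 1) * y β

/-- The cross term `Σ β (W(β) + W(β+1))`. -/
noncomputable def crossSum (x y : ℤ → ℝ) : ℝ :=
  ∑' β : ℤ, (β : ℝ) * (wronsk x y β + wronsk x y (β + 1))

/-- The dissipation of the cross term. -/
noncomputable def crossDissipation (α : ℝ) (x y : ℤ → ℝ) : ℝ :=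
  ∑' β : ℤ, (β : ℝ) * ((Sv α (β - 1) + Sv α β) * wronsk x y β
    + (Sv α β + Sv α (β + 1)) * wronsk x y (β + 1))

/-- The coercive form produced by transport of the cross term. -/
noncomputable def transportForm (α : ℝ) (x y : ℤ → ℝ) : ℝ :=
  ∑' β : ℤ, (mw α β * (halfDiff x β ^ 2 + halfDiff y β ^ 2)
    + β * (mw α (β + 1) - mw α (β - 1)) / 2 * (x β ^ 2 + y β ^ 2))

/-- The energy defect `Σ |u|²/m - m |u(β-1) + u(β+1)|²/4`. -/
noncomputable def defectEnergy (α : ℝ) (x y : ℤ → ℝ) : ℝ :=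
  ∑' β : ℤ, ((mw α β)⁻¹ * (x β ^ 2 + y β ^ 2)
    - 1 / 4 * (mw α β * (nbrSum x β ^ 2 + nbrSum y β ^ 2)))

/-- The dissipation of the energy defect. -/
noncomputable def defectDissipation (α : ℝ) (x y : ℤ → ℝ) : ℝ :=
  ∑' β : ℤ, (-2 * (Sv α β * (mw α β)⁻¹ * (x β ^ 2 + y β ^ 2))
    + 1 / 2 * (mw α β * (nbrSum x β * nbrSum (fun γ => Sv α γ * x γ) β
      + nbrSum y β * nbrSum (fun γ => Sv α γ * y γ) β)))

section Static

variable {α : ℝ} {x y c d : ℤ → ℝ}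

lemma Rapid.nbrSum (hx : Rapid x) : Rapid (nbrSum x) :=
  RapidOn.add (RapidOn.prev hx) (RapidOn.next hx)

lemma Rapid.halfDiff (hx : Rapid x) : Rapid (halfDiff x) := by
  have h : Rapid fun β => (1 / 2 : ℝ) * (x (β - 1) - x (β + 1)) :=
    RapidOn.weight (PolyBounded.const _) (RapidOn.sub (RapidOn.prev hx) (RapidOn.next hx))
  convert h using 3
  unfold _root_.halfDiff; ring

lemma Rapid.wronsk (hx : Rapid x) (hy : Rapid y) : Rapid (wronsk x y) :=
  RapidOn.sub (RapidOn.mul (RapidOn.prev hy) hx) (RapidOn.mul (RapidOn.prev hx) hy)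

lemma Rapid.energy (hc : PolyBounded c) (hx : Rapid x) (hy : Rapid y) :
    Rapid fun β => c β * (x β ^ 2 + y β ^ 2) :=
  RapidOn.weight hc (RapidOn.add (RapidOn.sq hx) (RapidOn.sq hy))

lemma Rapid.normSq (hx : Rapid x) (hy : Rapid y) : Rapid fun β => x β ^ 2 + y β ^ 2 :=
  RapidOn.add (RapidOn.sq hx) (RapidOn.sq hy)

lemma wEnergy_nonneg (hc : ∀ β, 0 ≤ c β) : 0 ≤ wEnergy c x y :=
  tsum_nonneg fun β => mul_nonneg (hc β) (by positivity)

lemma wEnergy_mono (hx : Rapid x) (hy : Rapid y) (hc : PolyBounded c) (hd : PolyBounded d)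
    (h : ∀ β, c β ≤ d β) : wEnergy c x y ≤ wEnergy d x y :=
  (hx.energy hc hy).tsum_le (hx.energy hd hy)
    fun β => mul_le_mul_of_nonneg_right (h β) (by positivity)

lemma wEnergy_add (hx : Rapid x) (hy : Rapid y) (hc : PolyBounded c) (hd : PolyBounded d) :
    wEnergy (fun β => c β + d β) x y = wEnergy c x y + wEnergy d x y := by
  unfold wEnergy
  rw [← (hx.energy hc hy).summable.tsum_add (hx.energy hd hy).summable]
  exact tsum_congr fun β => by ring

lemma wEnergy_const_mul (a : ℝ) : wEnergy (fun β => a * c β) x y = a * wEnergy c x y := by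
  unfold wEnergy
  rw [← tsum_mul_left]
  exact tsum_congr fun β => by ring

/-- The telescoping term that moves the weights of neighbouring entries onto the entry itself
is rapidly decaying. -/
lemma rapid_shift_terms {A B : ℤ → ℝ} (hA : PolyBounded A) (hB : PolyBounded B)
    (hx : Rapid x) (hy : Rapid y) :
    Rapid fun β => B (β - 1) * (x β ^ 2 + y β ^ 2)
      - A β * (x (β - 1) ^ 2 + y (β - 1) ^ 2) :=
  RapidOn.sub (hx.energy hB.prev hy) (RapidOn.weight hA (RapidOn.prev (hx.normSq hy)))

/-! ### Exact derivatives -/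

variable (ν k : ℝ)

lemma tsum_energy_rate {w : ℤ → ℝ} (hα : 1 < |α|) (hw : PolyBounded w) (hx : Rapid x)
    (hy : Rapid y) {dx dy : ℤ → ℝ}
    (hdx : ∀ β, dx β = -(ν * Sv α β) * x β + k * (mw α β * nbrSum y β))
    (hdy : ∀ β, dy β = -(ν * Sv α β) * y β - k * (mw α β * nbrSum x β)) :
    ∑' β, (w β * (mw α β)⁻¹) * (2 * x β * dx β + 2 * y β * dy β) =
      -2 * ν * wEnergy (fun β => w β * (Sv α β * (mw α β)⁻¹)) x y
        + 2 * k * ∑' β, w β * (wronsk x y β - wronsk x y (β + 1)) := by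
  have h1 : Rapid fun β => w β * (Sv α β * (mw α β)⁻¹) * (x β ^ 2 + y β ^ 2) :=
    hx.energy (hw.mul ((polyBounded_Sv α).mul (polyBounded_inv_mw hα))) hy
  have h2 : Rapid fun β => w β * (wronsk x y β - wronsk x y (β + 1)) :=
    RapidOn.weight hw (RapidOn.sub (hx.wronsk hy) (RapidOn.next (hx.wronsk hy)))
  unfold wEnergy
  rw [← tsum_mul_left, ← tsum_mul_left,
    ← (h1.summable.mul_left _).tsum_add (h2.summable.mul_left _)]
  refine tsum_congr fun β => ?_
  have h3 := (mw_pos hα β).ne'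
  rw [hdx, hdy]
  unfold wronsk nbrSum
  simp only [add_sub_cancel_right]
  field_simp
  ring

lemma tsum_wronsk_sub_next (hx : Rapid x) (hy : Rapid y) :
    ∑' β, (wronsk x y β - wronsk x y (β + 1)) = 0 := by
  have h := (tsum_shift_sub_eq_zero (hx.wronsk hy).summable.neg).2
  rw [← h]
  exact tsum_congr fun β => by ring

lemma tsum_sq_mul_wronsk_sub_next (hx : Rapid x) (hy : Rapid y) :
    ∑' β : ℤ, ((β : ℝ) * β) * (wronsk x y β - wronsk x y (β + 1)) = crossSum x y := by
  have hb := PolyBounded.cast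
  refine tsum_eq_of_telescope
    (H := fun β => -(((β : ℝ) * β - β) * wronsk x y β)) ?_ ?_ fun β => ?_
  · exact RapidOn.weight hb (RapidOn.add (hx.wronsk hy) (RapidOn.next (hx.wronsk hy)))
  · exact RapidOn.neg (RapidOn.weight ((hb.mul hb).sub hb) (hx.wronsk hy))
  · push_cast; ring

lemma tsum_crossSum_rate (hα : 1 < |α|) (hx : Rapid x) (hy : Rapid y) {dx dy : ℤ → ℝ}
    (hdx : ∀ β, dx β = -(ν * Sv α β) * x β + k * (mw α β * nbrSum y β))
    (hdy : ∀ β, dy β = -(ν * Sv α β) * y β - k * (mw α β * nbrSum x β)) :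
    ∑' β : ℤ, (β : ℝ) * (((dy (β - 1) * x β + y (β - 1) * dx β)
        - (dx (β - 1) * y β + x (β - 1) * dy β))
      + ((dy (β + 1 - 1) * x (β + 1) + y (β + 1 - 1) * dx (β + 1))
        - (dx (β + 1 - 1) * y (β + 1) + x (β + 1 - 1) * dy (β + 1)))) =
      -ν * crossDissipation α x y + 4 * k * transportForm α x y := by
  have hb := PolyBounded.cast
  have hS := polyBounded_Sv α
  have hm := polyBounded_mw hα
  have hp := hx.wronsk hy
  have h1 : Rapid fun β => (β : ℝ) * ((Sv α (β - 1) + Sv α β) * wronsk x y β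
      + (Sv α β + Sv α (β + 1)) * wronsk x y (β + 1)) :=
    RapidOn.weight hb (RapidOn.add (RapidOn.weight (hS.prev.add hS) hp)
      (RapidOn.weight (hS.add hS.next) (RapidOn.next hp)))
  have hw : PolyBounded fun β => (β : ℝ) * (mw α (β + 1) - mw α (β - 1)) / 2 := by
    simpa only [div_eq_mul_inv] using (hb.mul (hm.next.sub hm.prev)).mul (PolyBounded.const 2⁻¹)
  have h2 : Rapid fun β => mw α β * (halfDiff x β ^ 2 + halfDiff y β ^ 2)
      + (β : ℝ) * (mw α (β + 1) - mw α (β - 1)) / 2 * (x β ^ 2 + y β ^ 2) :=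
    RapidOn.add (hx.halfDiff.energy hm hy.halfDiff) (hx.energy hw hy)
  have ha : Rapid fun β => mw α β * (x (β - 1) * nbrSum x β + y (β - 1) * nbrSum y β) :=
    RapidOn.weight hm (RapidOn.add (RapidOn.mul (RapidOn.prev hx) hx.nbrSum)
      (RapidOn.mul (RapidOn.prev hy) hy.nbrSum))
  have hb' : Rapid fun β => mw α β * (x (β + 1) * nbrSum x β + y (β + 1) * nbrSum y β) :=
    RapidOn.weight hm (RapidOn.add (RapidOn.mul (RapidOn.next hx) hx.nbrSum)
      (RapidOn.mul (RapidOn.next hy) hy.nbrSum))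
  have h3 : Rapid fun β =>
      k * ((((β : ℝ) - 1) * (mw α β * (x (β - 1) * nbrSum x β + y (β - 1) * nbrSum y β))
        + (β : ℝ) * (mw α (β - 1) * (x (β - 1 + 1) * nbrSum x (β - 1)
            + y (β - 1 + 1) * nbrSum y (β - 1))))
        - ((2 * (β : ℝ)) * mw α (β - 1) * (x β ^ 2 + y β ^ 2)
          + (2 * ((β : ℝ) - 1)) * (mw α β) * (x (β - 1) ^ 2 + y (β - 1) ^ 2))) :=
    RapidOn.weight (PolyBounded.const k) (RapidOn.sub
      (RapidOn.add (RapidOn.weight (hb.sub (PolyBounded.const 1)) ha)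
        (RapidOn.weight hb (RapidOn.prev hb')))
      (RapidOn.add (hx.energy (((PolyBounded.const 2).mul hb).mul hm.prev) hy)
        (RapidOn.weight (((PolyBounded.const 2).mul (hb.sub (PolyBounded.const 1))).mul hm)
          (RapidOn.prev (hx.normSq hy)))))
  unfold crossDissipation transportForm
  rw [← tsum_mul_left, ← tsum_mul_left,
    ← (h1.summable.mul_left _).tsum_add (h2.summable.mul_left _)]
  refine tsum_eq_of_telescope (RapidOn.add (RapidOn.weight (PolyBounded.const _) h1)
    (RapidOn.weight (PolyBounded.const _) h2)) h3 fun β => ?_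
  simp only [hdx, hdy]
  unfold wronsk nbrSum halfDiff
  simp only [add_sub_cancel_right, sub_add_cancel]
  push_cast
  ring

lemma tsum_defect_rate (hα : 1 < |α|) (hx : Rapid x) (hy : Rapid y) {dx dy : ℤ → ℝ}
    (hdx : ∀ β, dx β = -(ν * Sv α β) * x β + k * (mw α β * nbrSum y β))
    (hdy : ∀ β, dy β = -(ν * Sv α β) * y β - k * (mw α β * nbrSum x β)) :
    ∑' β, ((mw α β)⁻¹ * (2 * x β * dx β + 2 * y β * dy β)
      - 1 / 4 * (mw α β * (2 * nbrSum x β * nbrSum dx β + 2 * nbrSum y β * nbrSum dy β))) =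
      ν * defectDissipation α x y := by
  have hS := polyBounded_Sv α
  have hm := polyBounded_mw hα
  have hi := polyBounded_inv_mw hα
  have h1 : Rapid fun β => -2 * (Sv α β * (mw α β)⁻¹ * (x β ^ 2 + y β ^ 2))
      + 1 / 2 * (mw α β * (nbrSum x β * nbrSum (fun γ => Sv α γ * x γ) β
        + nbrSum y β * nbrSum (fun γ => Sv α γ * y γ) β)) :=
    RapidOn.add (RapidOn.weight (PolyBounded.const _) (hx.energy (hS.mul hi) hy))
      (RapidOn.weight (PolyBounded.const _) (RapidOn.weight hm (RapidOn.add
        (RapidOn.mul hx.nbrSum (Rapid.nbrSum (RapidOn.weight hS hx)))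
        (RapidOn.mul hy.nbrSum (Rapid.nbrSum (RapidOn.weight hS hy))))))
  have h2 : Rapid fun β => k * (1 / 2 * ((mw α β * mw α (β - 1)) *
      (nbrSum y (β - 1) * nbrSum x β - nbrSum x (β - 1) * nbrSum y β)) - 2 * wronsk x y β) :=
    RapidOn.weight (PolyBounded.const k) (RapidOn.sub
      (RapidOn.weight (PolyBounded.const _) (RapidOn.weight (hm.mul hm.prev)
        (hx.nbrSum.wronsk hy.nbrSum)))
      (RapidOn.weight (PolyBounded.const _) (hx.wronsk hy)))
  unfold defectDissipation
  rw [← tsum_mul_left]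
  refine tsum_eq_of_telescope (RapidOn.weight (PolyBounded.const ν) h1) h2 fun β => ?_
  have h3 := (mw_pos hα β).ne'
  have h4 : (mw α β)⁻¹ * (2 * x β * dx β + 2 * y β * dy β) =
      -2 * ν * (Sv α β * (mw α β)⁻¹ * (x β ^ 2 + y β ^ 2))
        + 2 * k * (x β * nbrSum y β - y β * nbrSum x β) := by
    rw [hdx, hdy]; field_simp; ring
  rw [h4]
  unfold wronsk nbrSum
  simp only [hdx, hdy]
  unfold nbrSum
  simp only [add_sub_cancel_right, sub_add_cancel]
  ring

end Static

/-! ### Coercivity and comparison estimates -/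

lemma mul_sq_sub_sq_le {L : ℝ} (hL : 0 < L) (g a b : ℝ) :
    (g - 2 / L * g ^ 2) * a ^ 2 + (-g - 2 / L * g ^ 2) * b ^ 2 ≤ L * ((a - b) / 2) ^ 2 := by
  have h1 : 0 ≤ (L * ((a - b) / 2) - g * (a + b)) ^ 2 / L := by positivity
  have h2 : (L * ((a - b) / 2) - g * (a + b)) ^ 2 / L =
      L * ((a - b) / 2) ^ 2 - g * (a ^ 2 - b ^ 2) + g ^ 2 * (a + b) ^ 2 / L := by
    field_simp; ring
  have h3 : 0 ≤ g ^ 2 * (a - b) ^ 2 / L := by positivity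
  have h4 : g ^ 2 * (a + b) ^ 2 / L + g ^ 2 * (a - b) ^ 2 / L =
      2 / L * g ^ 2 * a ^ 2 + 2 / L * g ^ 2 * b ^ 2 := by
    field_simp; ring
  linarith

lemma mul_le_of_sq_le {c p q A B w : ℝ} (hp : 0 ≤ p) (hq : 0 ≤ q) (hc : c ^ 2 ≤ 4 * p * q)
    (hA : 0 ≤ A) (hB : 0 ≤ B) (hw : w ^ 2 ≤ A * B) : c * w ≤ p * A + q * B := by
  refine abs_le_of_sq_le_sq' ?_ (by positivity) |>.2
  calc (c * w) ^ 2 = c ^ 2 * w ^ 2 := by ring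
    _ ≤ (4 * p * q) * (A * B) := mul_le_mul hc hw (sq_nonneg _) (by positivity)
    _ ≤ (p * A + q * B) ^ 2 := by nlinarith [sq_nonneg (p * A - q * B)]

lemma sq_weight_le {r S T b B : ℝ} (hr : 0 < r) (hr1 : 1 ≤ r) (h0 : 0 < S) (haS : r ^ 2 ≤ S)
    (hT : 0 < T) (hST : S ^ 2 ≤ 4 * T) (hb : b ^ 2 ≤ 2 * (B ^ 2 + 1)) :
    2 / (2048 * r) * (r ^ 2 * b / T) ^ 2 ≤
      1 / 32 * (r * (B ^ 2 * S⁻¹ ^ 3)) + 1 / 32 * (r ^ 2 / S ^ 2) := by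
  have e1 : S ^ 4 ≤ 16 * T ^ 2 := by
    calc S ^ 4 = S ^ 2 * S ^ 2 := by ring
      _ ≤ (4 * T) * (4 * T) := mul_le_mul hST hST (by positivity) (by positivity)
      _ = _ := by ring
  have e2 : 2 / (2048 * r) * (r ^ 2 * b / T) ^ 2 = r ^ 3 * b ^ 2 / (1024 * T ^ 2) := by
    field_simp; ring
  have e3 : r ^ 3 * b ^ 2 / (1024 * T ^ 2) ≤
      r ^ 3 * (2 * (B ^ 2 + 1)) / (64 * S ^ 4) := by
    exact div_le_div₀ (by positivity) (by gcongr) (by positivity) (by linarith)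
  have e4 : r ^ 3 * (2 * (B ^ 2 + 1)) / (64 * S ^ 4) =
      1 / 32 * (r * B ^ 2 * (r ^ 2) / S ^ 4) + 1 / 32 * (r ^ 2 * r / S ^ 4) := by
    field_simp; ring
  have e5 : r * B ^ 2 * (r ^ 2) / S ^ 4 ≤ r * (B ^ 2 * S⁻¹ ^ 3) := by
    calc r * B ^ 2 * (r ^ 2) / S ^ 4 ≤ r * B ^ 2 * S / S ^ 4 := by gcongr
      _ = _ := by field_simp
  have e6 : r ^ 2 * r / S ^ 4 ≤ r ^ 2 / S ^ 2 := by
    calc r ^ 2 * r / S ^ 4 ≤ r ^ 2 * S ^ 2 / S ^ 4 := by gcongr; nlinarith [mul_self_nonneg (S - r)]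
      _ = _ := by field_simp
  rw [e2]
  linarith

section Estimates

variable {α : ℝ} {x y : ℤ → ℝ}

/-- The multiplier behind the discrete uncertainty principle. -/
lemma uncertainty_weight (hα : 1 < |α|) {r : ℝ} (hr : 0 < r) (hr2 : r ^ 2 = |α|) (β : ℤ) :
    1 / 16 * (Sv α β)⁻¹ - 66 * r * ((β : ℝ) ^ 2 * ((Sv α β)⁻¹) ^ 3) ≤
      (|α| * ((β + 1 : ℤ) : ℝ) / Sv α (β + 1) ^ 2
          - 2 / (2048 * r) * (|α| * ((β + 1 : ℤ) : ℝ) / Sv α (β + 1) ^ 2) ^ 2)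
        + (-(|α| * ((β - 1 : ℤ) : ℝ) / Sv α (β - 1) ^ 2)
          - 2 / (2048 * r) * (|α| * ((β - 1 : ℤ) : ℝ) / Sv α (β - 1) ^ 2) ^ 2) := by
  have h0 := Sv_pos hα β
  have h1 := Sv_pos hα (β + 1)
  have h2 := Sv_pos hα (β - 1)
  have hS1 := one_lt_Sv hα β
  have hr1 : 1 ≤ r := by nlinarith
  have haS : r ^ 2 ≤ Sv α β := hr2 ▸ abs_le_Sv α β
  have hP1 : Sv α (β + 1) ^ 2 ≤ 4 * Sv α β ^ 2 := by nlinarith [Sv_next_le_two_mul hα β]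
  have hQ1 : Sv α (β - 1) ^ 2 ≤ 4 * Sv α β ^ 2 := by nlinarith [Sv_prev_le_two_mul hα β]
  have hP2 : Sv α β ^ 2 ≤ 4 * Sv α (β + 1) ^ 2 := by
    nlinarith [Sv_le_next α β, one_lt_Sv hα (β + 1)]
  have hQ2 : Sv α β ^ 2 ≤ 4 * Sv α (β - 1) ^ 2 := by
    nlinarith [Sv_le_prev α β, one_lt_Sv hα (β - 1)]
  have hP := Sv_next_sq α β
  have hQ := Sv_prev_sq α β
  have hW := Sv_sq α β
  have hα2 : α ^ 2 = r ^ 4 := by rw [← sq_abs, ← hr2]; ring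
  rw [← hr2]
  set S := Sv α β with hS
  set P := Sv α (β + 1) ^ 2 with hPd
  set Q := Sv α (β - 1) ^ 2 with hQd
  have hPp : 0 < P := by positivity
  have hQp : 0 < Q := by positivity
  push_cast
  have hdiff : r ^ 2 * ((β : ℝ) + 1) / P - r ^ 2 * ((β : ℝ) - 1) / Q =
      2 * r ^ 2 * (S ^ 2 + 1) / (P * Q) - 4 * r ^ 2 * (β : ℝ) ^ 2 / (P * Q) := by
    rw [div_sub_div _ _ hPp.ne' hQp.ne', ← sub_div, hP, hQ]
    congr 1
    ring
  have hPQ1 : P * Q ≤ 16 * S ^ 4 := by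
    calc P * Q ≤ (4 * S ^ 2) * (4 * S ^ 2) := mul_le_mul hP1 hQ1 hQp.le (by positivity)
      _ = _ := by ring
  have hPQ2 : S ^ 4 ≤ 16 * (P * Q) := by
    calc S ^ 4 = S ^ 2 * S ^ 2 := by ring
      _ ≤ (4 * P) * (4 * Q) := mul_le_mul hP2 hQ2 (by positivity) (by positivity)
      _ = _ := by ring
  have hfirst : r ^ 2 / (8 * S ^ 2) ≤ 2 * r ^ 2 * (S ^ 2 + 1) / (P * Q) := by
    calc r ^ 2 / (8 * S ^ 2) = 2 * r ^ 2 * S ^ 2 / (16 * S ^ 4) := by field_simp; norm_num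
      _ ≤ 2 * r ^ 2 * (S ^ 2 + 1) / (P * Q) := by gcongr; linarith
  have hsecond : 4 * r ^ 2 * (β : ℝ) ^ 2 / (P * Q) ≤ 64 * r * ((β : ℝ) ^ 2 * S⁻¹ ^ 3) := by
    rw [div_le_iff₀ (by positivity)]
    calc 4 * r ^ 2 * (β : ℝ) ^ 2 ≤ 4 * S * (β : ℝ) ^ 2 := by gcongr
      _ = 4 * (β : ℝ) ^ 2 * S⁻¹ ^ 3 * S ^ 4 := by field_simp
      _ ≤ 4 * (β : ℝ) ^ 2 * S⁻¹ ^ 3 * (16 * (P * Q)) := by gcongr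
      _ = 1 * (64 * ((β : ℝ) ^ 2 * S⁻¹ ^ 3) * (P * Q)) := by ring
      _ ≤ r * (64 * ((β : ℝ) ^ 2 * S⁻¹ ^ 3) * (P * Q)) := by gcongr
      _ = _ := by ring
  have hA := sq_weight_le hr hr1 h0 haS hPp hP2 (b := (β : ℝ) + 1) (B := β)
    (by nlinarith [sq_nonneg ((β : ℝ) - 1)])
  have hB := sq_weight_le hr hr1 h0 haS hQp hQ2 (b := (β : ℝ) - 1) (B := β)
    (by nlinarith [sq_nonneg ((β : ℝ) + 1)])
  have hinv : S⁻¹ ≤ r ^ 2 / S ^ 2 + (β : ℝ) ^ 2 * S⁻¹ ^ 3 := by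
    calc S⁻¹ = S ^ 2 / S ^ 3 := by field_simp
      _ = r ^ 2 * r ^ 2 / S ^ 3 + (β : ℝ) ^ 2 * S⁻¹ ^ 3 := by
        rw [hW, hα2, inv_pow]; ring
      _ ≤ r ^ 2 * S / S ^ 3 + (β : ℝ) ^ 2 * S⁻¹ ^ 3 := by gcongr
      _ = _ := by field_simp
  have h8 : r ^ 2 / (8 * S ^ 2) = 1 / 8 * (r ^ 2 / S ^ 2) := by field_simp
  have hY : (β : ℝ) ^ 2 * S⁻¹ ^ 3 ≤ r * ((β : ℝ) ^ 2 * S⁻¹ ^ 3) :=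
    le_mul_of_one_le_left (by positivity) hr1
  have hY0 : 0 ≤ r * ((β : ℝ) ^ 2 * S⁻¹ ^ 3) := by positivity
  linarith

lemma polyBounded_uncertainty (hα : 1 < |α|) :
    PolyBounded fun β => |α| * (β : ℝ) / Sv α β ^ 2 := by
  have hi := polyBounded_inv_Sv hα
  have h := ((PolyBounded.const |α|).mul PolyBounded.cast).mul (hi.mul hi)
  convert h using 2
  rw [div_eq_mul_inv, sq, mul_inv]

lemma polyBounded_sq_mul_inv_Sv_cube (hα : 1 < |α|) :
    PolyBounded fun β => (β : ℝ) ^ 2 * ((Sv α β)⁻¹) ^ 3 := by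
  have hi := polyBounded_inv_Sv hα
  have h := (PolyBounded.cast.mul PolyBounded.cast).mul ((hi.mul hi).mul hi)
  convert h using 2
  ring

/-- Discrete uncertainty principle. -/
lemma wEnergy_inv_Sv_le (hα : 1 < |α|) {r : ℝ} (hr : 0 < r) (hr2 : r ^ 2 = |α|)
    (hx : Rapid x) (hy : Rapid y) :
    wEnergy (fun β => (Sv α β)⁻¹) x y ≤
      40000 * r * (wEnergy (fun _ => 1) (halfDiff x) (halfDiff y)
        + wEnergy (fun β => (β : ℝ) ^ 2 * ((Sv α β)⁻¹) ^ 3) x y) := by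
  have hi := polyBounded_inv_Sv hα
  have hg := polyBounded_uncertainty hα
  have hY := polyBounded_sq_mul_inv_Sv_cube hα
  have hg2 : PolyBounded fun β => 2 / (2048 * r) * (|α| * (β : ℝ) / Sv α β ^ 2) ^ 2 := by
    simpa only [sq (_ / _)] using (PolyBounded.const (2 / (2048 * r))).mul (hg.mul hg)
  have hA : PolyBounded fun β : ℤ => |α| * (β : ℝ) / Sv α β ^ 2
      - 2 / (2048 * r) * (|α| * (β : ℝ) / Sv α β ^ 2) ^ 2 := hg.sub hg2
  have hB : PolyBounded fun β : ℤ => -(|α| * (β : ℝ) / Sv α β ^ 2)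
      - 2 / (2048 * r) * (|α| * (β : ℝ) / Sv α β ^ 2) ^ 2 := hg.neg.sub hg2
  have hw : PolyBounded fun β => 1 / 16 * (Sv α β)⁻¹
      + (-(66 * r)) * ((β : ℝ) ^ 2 * ((Sv α β)⁻¹) ^ 3) :=
    ((PolyBounded.const _).mul hi).add ((PolyBounded.const _).mul hY)
  have key : wEnergy (fun β => 1 / 16 * (Sv α β)⁻¹
      + (-(66 * r)) * ((β : ℝ) ^ 2 * ((Sv α β)⁻¹) ^ 3)) x y ≤
      wEnergy (fun _ => 2048 * r * 1) (halfDiff x) (halfDiff y) := by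
    refine tsum_le_of_telescope (hx.energy hw hy)
      (hx.halfDiff.energy (PolyBounded.const _) hy.halfDiff)
      (rapid_shift_terms hA.neg hB.neg hx hy) fun β => ?_
    have h1 := uncertainty_weight hα hr hr2 β
    have h2 := mul_sq_sub_sq_le (L := 2048 * r) (by positivity)
      (|α| * (β : ℝ) / Sv α β ^ 2) (x (β - 1)) (x (β + 1))
    have h3 := mul_sq_sub_sq_le (L := 2048 * r) (by positivity)
      (|α| * (β : ℝ) / Sv α β ^ 2) (y (β - 1)) (y (β + 1))
    have h4 : 0 ≤ x β ^ 2 + y β ^ 2 := by positivity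
    have h5 := mul_le_mul_of_nonneg_right h1 h4
    unfold halfDiff
    simp only [add_sub_cancel_right]
    linarith
  rw [wEnergy_add hx hy ((PolyBounded.const _).mul hi) ((PolyBounded.const _).mul hY),
    wEnergy_const_mul, wEnergy_const_mul, wEnergy_const_mul] at key
  have hX0 : 0 ≤ wEnergy (fun _ => 1) (halfDiff x) (halfDiff y) :=
    wEnergy_nonneg fun _ => zero_le_one
  have hY0 : 0 ≤ wEnergy (fun β => (β : ℝ) ^ 2 * ((Sv α β)⁻¹) ^ 3) x y :=
    wEnergy_nonneg fun β => by have := Sv_nonneg α β; positivity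
  have := mul_nonneg hr.le hX0
  have := mul_nonneg hr.le hY0
  nlinarith

lemma transportForm_ge (hα : 1 < |α|) {m₀ : ℝ} (h0 : 0 < m₀) (h1 : m₀ ≤ 1)
    (hm₀ : ∀ β, m₀ ≤ mw α β) (hx : Rapid x) (hy : Rapid y) :
    m₀ / 8 * (wEnergy (fun _ => 1) (halfDiff x) (halfDiff y)
        + wEnergy (fun β => (β : ℝ) ^ 2 * ((Sv α β)⁻¹) ^ 3) x y) ≤ transportForm α x y := by
  have hm := polyBounded_mw hα
  have hY := polyBounded_sq_mul_inv_Sv_cube hα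
  have hw : PolyBounded fun β => (β : ℝ) * (mw α (β + 1) - mw α (β - 1)) / 2 := by
    simpa only [div_eq_mul_inv] using
      (PolyBounded.cast.mul (hm.next.sub hm.prev)).mul (PolyBounded.const 2⁻¹)
  have hX' := hx.halfDiff.energy (PolyBounded.const 1) hy.halfDiff
  have hY' := hx.energy hY hy
  unfold transportForm wEnergy
  rw [← hX'.summable.tsum_add hY'.summable, ← tsum_mul_left]
  refine Rapid.tsum_le (RapidOn.weight (PolyBounded.const _) (RapidOn.add hX' hY'))
    (RapidOn.add (hx.halfDiff.energy hm hy.halfDiff) (hx.energy hw hy)) fun β => ?_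
  have e1 := mul_mw_next_sub_prev hα β
  have e2 : 0 ≤ halfDiff x β ^ 2 + halfDiff y β ^ 2 := by positivity
  have e3 : 0 ≤ x β ^ 2 + y β ^ 2 := by positivity
  have e4 : m₀ / 8 * (halfDiff x β ^ 2 + halfDiff y β ^ 2) ≤
      mw α β * (halfDiff x β ^ 2 + halfDiff y β ^ 2) :=
    mul_le_mul_of_nonneg_right (by linarith [hm₀ β]) e2
  have e5 : 0 ≤ (β : ℝ) ^ 2 * ((Sv α β)⁻¹) ^ 3 := by have := Sv_nonneg α β; positivity
  have e6 : m₀ / 8 * ((β : ℝ) ^ 2 * ((Sv α β)⁻¹) ^ 3 * (x β ^ 2 + y β ^ 2)) ≤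
      (β : ℝ) * (mw α (β + 1) - mw α (β - 1)) / 2 * (x β ^ 2 + y β ^ 2) := by
    rw [← mul_assoc]
    refine mul_le_mul_of_nonneg_right ?_ e3
    nlinarith
  linarith

lemma rapid_defect (hα : 1 < |α|) (hx : Rapid x) (hy : Rapid y) :
    Rapid fun β => (mw α β)⁻¹ * (x β ^ 2 + y β ^ 2)
      - 1 / 4 * (mw α β * (nbrSum x β ^ 2 + nbrSum y β ^ 2)) :=
  RapidOn.sub (hx.energy (polyBounded_inv_mw hα) hy)
    (RapidOn.weight (PolyBounded.const _) (hx.nbrSum.energy (polyBounded_mw hα) hy.nbrSum))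

lemma le_defectEnergy (hα : 1 < |α|) (hx : Rapid x) (hy : Rapid y) :
    wEnergy (fun _ => 1) (halfDiff x) (halfDiff y) ≤ defectEnergy α x y := by
  refine tsum_le_of_telescope (hx.halfDiff.energy (PolyBounded.const 1) hy.halfDiff)
    (rapid_defect hα hx hy)
    (rapid_shift_terms (PolyBounded.const (1 / 2)) (PolyBounded.const (1 / 2)) hx hy)
    fun β => ?_
  have e1 : 0 ≤ x β ^ 2 + y β ^ 2 := by positivity
  have e2 : 0 ≤ nbrSum x β ^ 2 + nbrSum y β ^ 2 := by positivity
  have e3 := mul_le_mul_of_nonneg_right (one_le_inv_mw hα β) e1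
  have e4 := mul_le_mul_of_nonneg_right (mw_le_one α β) e2
  unfold halfDiff
  simp only [add_sub_cancel_right]
  unfold nbrSum at e4 ⊢
  linarith

lemma defectEnergy_le (hα : 1 < |α|) {m₀ : ℝ} (h0 : 0 < m₀) (h1 : m₀ ≤ 1)
    (hm₀ : ∀ β, m₀ ≤ mw α β) (hx : Rapid x) (hy : Rapid y) :
    defectEnergy α x y ≤ wEnergy (fun _ => 1) (halfDiff x) (halfDiff y)
      + 3 / m₀ * wEnergy (fun β => (Sv α β)⁻¹) x y := by
  have hi := polyBounded_inv_Sv hα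
  have hX' := hx.halfDiff.energy (PolyBounded.const 1) hy.halfDiff
  have hZ' := hx.energy hi hy
  have hA : PolyBounded fun β => -(1 / 2) + 1 / 2 * (Sv α β)⁻¹ :=
    (PolyBounded.const _).add ((PolyBounded.const _).mul hi)
  unfold defectEnergy wEnergy
  rw [← tsum_mul_left, ← hX'.summable.tsum_add (hZ'.summable.mul_left _)]
  refine tsum_le_of_telescope (rapid_defect hα hx hy)
    (RapidOn.add hX' (RapidOn.weight (PolyBounded.const _) hZ'))
    (rapid_shift_terms hA hA hx hy) fun β => ?_
  have hS := inv_pos.mpr (Sv_pos hα β)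
  have e1 : 0 ≤ x β ^ 2 + y β ^ 2 := by positivity
  have e2 : (mw α β)⁻¹ + (-(1 / 2) + 1 / 2 * (Sv α (β + 1))⁻¹)
      + (-(1 / 2) + 1 / 2 * (Sv α (β - 1))⁻¹) ≤ 3 / m₀ * (Sv α β)⁻¹ := by
    have f1 := inv_Sv_next_le hα β
    have f2 := inv_Sv_prev_le hα β
    have f3 : (mw α β)⁻¹ ≤ m₀⁻¹ := inv_anti₀ h0 (hm₀ β)
    have f4 : 1 ≤ m₀⁻¹ := (one_le_inv₀ h0).mpr h1
    have f5 := inv_mw_eq hα β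
    have f6 := mul_le_mul_of_nonneg_left f3 hS.le
    have f7 := mul_le_mul_of_nonneg_left f4 hS.le
    have f8 : 3 / m₀ * (Sv α β)⁻¹ = 3 * ((Sv α β)⁻¹ * m₀⁻¹) := by rw [div_eq_mul_inv]; ring
    linarith
  have e3 := mul_le_mul_of_nonneg_right e2 e1
  have e4 : mw α β = 1 - (Sv α β)⁻¹ := rfl
  have e5 : 0 ≤ (Sv α β)⁻¹ * ((x (β - 1) - x (β + 1)) ^ 2 + (y (β - 1) - y (β + 1)) ^ 2) := by
    positivity
  unfold halfDiff nbrSum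
  simp only [add_sub_cancel_right]
  rw [e4] at e3 ⊢
  linarith

end Estimates

section CrossEstimates

variable {α : ℝ} {x y : ℤ → ℝ}

lemma wronsk_add_next (x y : ℤ → ℝ) (β : ℤ) :
    wronsk x y β + wronsk x y (β + 1) = 2 * (halfDiff y β * x β - halfDiff x β * y β) := by
  unfold wronsk halfDiff
  simp only [add_sub_cancel_right]
  ring

lemma mul_halfDiff_cross_le {c p q : ℝ} (hp : 0 ≤ p) (hq : 0 ≤ q) (hc : c ^ 2 ≤ 4 * p * q)
    (x y : ℤ → ℝ) (β : ℤ) :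
    c * (β * (halfDiff y β * x β - halfDiff x β * y β)) ≤
      p * ((β : ℝ) * β * (x β ^ 2 + y β ^ 2)) + q * (halfDiff x β ^ 2 + halfDiff y β ^ 2) := by
  refine mul_le_of_sq_le hp hq hc (mul_nonneg (mul_self_nonneg _) (by positivity))
    (by positivity) ?_
  nlinarith [sq_nonneg ((β : ℝ) * (halfDiff x β * x β + halfDiff y β * y β))]

lemma wronsk_abs_le (x y : ℤ → ℝ) (β : ℤ) :
    |wronsk x y β| ≤ (x β ^ 2 + y β ^ 2) / 2 + (x (β - 1) ^ 2 + y (β - 1) ^ 2) / 2 := by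
  unfold wronsk
  rw [abs_le]
  constructor <;>
    nlinarith [sq_nonneg (y (β - 1) - x β), sq_nonneg (y (β - 1) + x β),
      sq_nonneg (x (β - 1) - y β), sq_nonneg (x (β - 1) + y β)]

lemma mul_crossSum_le (hα : 1 < |α|) {c p q : ℝ} (hp : 0 ≤ p) (hq : 0 ≤ q)
    (hc : c ^ 2 ≤ 4 * p * q) (hx : Rapid x) (hy : Rapid y) :
    c * crossSum x y ≤ 2 * (p * wEnergy (fun β => (β : ℝ) * β * (mw α β)⁻¹) x y
      + q * wEnergy (fun _ => 1) (halfDiff x) (halfDiff y)) := by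
  have hb := PolyBounded.cast
  have h1 := hx.energy ((hb.mul hb).mul (polyBounded_inv_mw hα)) hy
  have h2 := hx.halfDiff.energy (PolyBounded.const 1) hy.halfDiff
  have h3 : Rapid fun β => (β : ℝ) * (wronsk x y β + wronsk x y (β + 1)) :=
    RapidOn.weight hb (RapidOn.add (hx.wronsk hy) (RapidOn.next (hx.wronsk hy)))
  unfold crossSum wEnergy
  rw [← tsum_mul_left, ← tsum_mul_left, ← tsum_mul_left,
    ← (h1.summable.mul_left _).tsum_add (h2.summable.mul_left _), ← tsum_mul_left]
  refine Rapid.tsum_le (RapidOn.weight (PolyBounded.const c) h3)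
    (RapidOn.weight (PolyBounded.const 2) (RapidOn.add (RapidOn.weight (PolyBounded.const p) h1)
      (RapidOn.weight (PolyBounded.const q) h2))) fun β => ?_
  have e1 := mul_halfDiff_cross_le hp hq hc x y β
  have e2 : 0 ≤ p * ((β : ℝ) * β * (x β ^ 2 + y β ^ 2)) :=
    mul_nonneg hp (mul_nonneg (mul_self_nonneg _) (by positivity))
  have e3 := le_mul_of_one_le_right e2 (one_le_inv_mw hα β)
  rw [wronsk_add_next]
  linarith

lemma mul_crossDissipation_le (hα : 1 < |α|) {c p q : ℝ} (hp : 0 ≤ p) (hq : 0 ≤ q)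
    (hc : c ^ 2 ≤ 4 * p * q) (hx : Rapid x) (hy : Rapid y) :
    c * crossDissipation α x y ≤
      4 * p * wEnergy (fun β => (β : ℝ) * β * (Sv α β * (mw α β)⁻¹)) x y
        + 4 * q * wEnergy (Sv α) (halfDiff x) (halfDiff y)
        + 3 * |c| * wEnergy (fun β => Sv α β * (mw α β)⁻¹) x y := by
  have hb := PolyBounded.cast
  have hS := polyBounded_Sv α
  have hi := polyBounded_inv_mw hα
  have hw := hx.wronsk hy
  have h1 := hx.energy ((hb.mul hb).mul (hS.mul hi)) hy
  have h2 := hx.halfDiff.energy hS hy.halfDiff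
  have h3 := hx.energy (hS.mul hi) hy
  have h4 : Rapid fun β => (β : ℝ) * ((Sv α (β - 1) + Sv α β) * wronsk x y β
      + (Sv α β + Sv α (β + 1)) * wronsk x y (β + 1)) :=
    RapidOn.weight hb (RapidOn.add (RapidOn.weight (hS.prev.add hS) hw)
      (RapidOn.weight (hS.add hS.next) (RapidOn.next hw)))
  have hA : PolyBounded fun β : ℤ => |c| / 2 * |(β : ℝ)| :=
    (PolyBounded.const _).mul (hb.mono fun β => by simp)
  unfold crossDissipation wEnergy
  rw [← tsum_mul_left, ← tsum_mul_left, ← tsum_mul_left, ← tsum_mul_left,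
    ← (h1.summable.mul_left _).tsum_add (h2.summable.mul_left _),
    ← ((h1.summable.mul_left _).add (h2.summable.mul_left _)).tsum_add (h3.summable.mul_left _)]
  refine tsum_le_of_telescope (RapidOn.weight (PolyBounded.const c) h4)
    (RapidOn.add (RapidOn.add (RapidOn.weight (PolyBounded.const _) h1)
      (RapidOn.weight (PolyBounded.const _) h2)) (RapidOn.weight (PolyBounded.const _) h3))
    (rapid_shift_terms hA hA hx hy) fun β => ?_
  have hSp := Sv_pos hα β
  have hinv := one_le_inv_mw hα β
  have hn : 0 ≤ x β ^ 2 + y β ^ 2 := by positivity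
  have e1 := mul_le_mul_of_nonneg_left (mul_halfDiff_cross_le hp hq hc x y β)
    (by positivity : 0 ≤ 4 * Sv α β)
  have e2 : 0 ≤ 4 * Sv α β * (p * ((β : ℝ) * β * (x β ^ 2 + y β ^ 2))) :=
    mul_nonneg (by positivity) (mul_nonneg hp (mul_nonneg (mul_self_nonneg _) hn))
  have e3 := le_mul_of_one_le_right e2 hinv
  have bound : ∀ D W N : ℝ, |D| ≤ 1 → |W| ≤ N → c * (β * (D * W)) ≤ |c| * |(β : ℝ)| * N := by
    intro D W N hD hW
    calc c * (β * (D * W)) ≤ |c * (β * (D * W))| := le_abs_self _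
      _ = |c| * |(β : ℝ)| * (|D| * |W|) := by rw [abs_mul, abs_mul, abs_mul]; ring
      _ ≤ |c| * |(β : ℝ)| * (1 * N) := by gcongr
      _ = _ := by ring
  have e4 := bound (Sv α (β - 1) - Sv α β) _ _
    (abs_le.mpr ⟨by linarith [Sv_le_prev α β], by linarith [Sv_prev_le α β]⟩)
    (wronsk_abs_le x y β)
  have e5 := bound (Sv α (β + 1) - Sv α β) _ _
    (abs_le.mpr ⟨by linarith [Sv_le_next α β], by linarith [Sv_next_le α β]⟩)
    (wronsk_abs_le x y (β + 1))
  have e6 : |c| * |(β : ℝ)| + |c| / 2 * |((β + 1 : ℤ) : ℝ)| + |c| / 2 * |((β - 1 : ℤ) : ℝ)| ≤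
      3 * |c| * Sv α β := by
    have f1 := abs_index_le_Sv α β
    have f2 := (abs_index_le_Sv α (β + 1)).trans (Sv_next_le_two_mul hα β)
    have f3 := (abs_index_le_Sv α (β - 1)).trans (Sv_prev_le_two_mul hα β)
    have f0 := abs_nonneg c
    nlinarith
  have e7 := mul_le_mul_of_nonneg_right e6 hn
  have e8 : 0 ≤ 3 * |c| * Sv α β * (x β ^ 2 + y β ^ 2) := by positivity
  have e9 := le_mul_of_one_le_right e8 hinv
  have e10 : c * (β * ((Sv α (β - 1) + Sv α β) * wronsk x y β
      + (Sv α β + Sv α (β + 1)) * wronsk x y (β + 1))) =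
      4 * Sv α β * (c * (β * (halfDiff y β * x β - halfDiff x β * y β)))
      + c * (β * ((Sv α (β - 1) - Sv α β) * wronsk x y β))
      + c * (β * ((Sv α (β + 1) - Sv α β) * wronsk x y (β + 1))) := by
    linear_combination (2 * c * β * Sv α β) * wronsk_add_next x y β
  rw [e10]
  simp only [add_sub_cancel_right] at e5 ⊢
  linarith

lemma mul_weighted_sum_le {S P Q i a b : ℝ} (hSi : S * i = 1) (hi : 0 ≤ i)
    (hδ : 2 * S ≤ P + Q) (hP1 : P ≤ S + 1) (hP2 : S ≤ P + 1) (hQ1 : Q ≤ S + 1)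
    (hQ2 : S ≤ Q + 1) :
    1 / 2 * ((1 - i) * ((a + b) * (Q * a + P * b))) ≤
      -2 * (S * ((a - b) / 2) ^ 2)
        + (1 / 2 * (Q + S) + 1 / 4 * (P + Q - 2 * S) + i) * a ^ 2
        + (1 / 2 * (P + S) + 1 / 4 * (P + Q - 2 * S) + i) * b ^ 2 := by
  have h1 : 0 ≤ (P + Q - 2 * S) * (a - b) ^ 2 := mul_nonneg (by linarith) (sq_nonneg _)
  have h2 : -(2 * (a ^ 2 + b ^ 2)) ≤ (a + b) * ((Q - S) * a + (P - S) * b) := by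
    have f1 : 0 ≤ (1 + (Q - S)) * a ^ 2 := mul_nonneg (by linarith only [hQ2]) (sq_nonneg _)
    have f2 : 0 ≤ (1 + (P - S)) * b ^ 2 := mul_nonneg (by linarith) (sq_nonneg _)
    have f3 : 0 ≤ (2 - (P - S) - (Q - S)) * (a - b) ^ 2 :=
      mul_nonneg (by linarith) (sq_nonneg _)
    have f4 : 0 ≤ (2 + (P - S) + (Q - S)) * (a + b) ^ 2 :=
      mul_nonneg (by linarith) (sq_nonneg _)
    nlinarith
  have h3 := mul_le_mul_of_nonneg_left h2 hi
  have h4 : i * ((a + b) * (Q * a + P * b)) =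
      (a + b) ^ 2 + i * ((a + b) * ((Q - S) * a + (P - S) * b)) := by
    linear_combination (a + b) ^ 2 * hSi
  nlinarith [sq_nonneg (a + b)]

lemma defectDissipation_le (hα : 1 < |α|) (hx : Rapid x) (hy : Rapid y) :
    defectDissipation α x y ≤ -2 * wEnergy (fun β => (mw α β)⁻¹) x y
      - 2 * wEnergy (Sv α) (halfDiff x) (halfDiff y)
      + 6 * wEnergy (fun β => (Sv α β)⁻¹) x y := by
  have hS := polyBounded_Sv α
  have hm := polyBounded_mw hα
  have hi := polyBounded_inv_Sv hα
  have hmi := polyBounded_inv_mw hα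
  have h1 := hx.energy hmi hy
  have h2 := hx.halfDiff.energy hS hy.halfDiff
  have h3 := hx.energy hi hy
  have h4 : Rapid fun β => -2 * (Sv α β * (mw α β)⁻¹ * (x β ^ 2 + y β ^ 2))
      + 1 / 2 * (mw α β * (nbrSum x β * nbrSum (fun γ => Sv α γ * x γ) β
        + nbrSum y β * nbrSum (fun γ => Sv α γ * y γ) β)) :=
    RapidOn.add (RapidOn.weight (PolyBounded.const _) (hx.energy (hS.mul hmi) hy))
      (RapidOn.weight (PolyBounded.const _) (RapidOn.weight hm (RapidOn.add
        (RapidOn.mul hx.nbrSum (Rapid.nbrSum (RapidOn.weight hS hx)))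
        (RapidOn.mul hy.nbrSum (Rapid.nbrSum (RapidOn.weight hS hy))))))
  have hδ : PolyBounded fun β => 1 / 4 * (Sv α (β + 1) + Sv α (β - 1) - 2 * Sv α β) :=
    (PolyBounded.const _).mul ((hS.next.add hS.prev).sub ((PolyBounded.const _).mul hS))
  have hA : PolyBounded fun β => 1 / 2 * (Sv α (β - 1) + Sv α β)
      + 1 / 4 * (Sv α (β + 1) + Sv α (β - 1) - 2 * Sv α β) + (Sv α β)⁻¹ :=
    (((PolyBounded.const _).mul (hS.prev.add hS)).add hδ).add hi
  have hB : PolyBounded fun β => 1 / 2 * (Sv α (β + 1) + Sv α β)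
      + 1 / 4 * (Sv α (β + 1) + Sv α (β - 1) - 2 * Sv α β) + (Sv α β)⁻¹ :=
    (((PolyBounded.const _).mul (hS.next.add hS)).add hδ).add hi
  unfold defectDissipation wEnergy
  rw [← tsum_mul_left, ← tsum_mul_left, ← tsum_mul_left,
    ← (h1.summable.mul_left _).tsum_sub (h2.summable.mul_left _),
    ← ((h1.summable.mul_left _).sub (h2.summable.mul_left _)).tsum_add (h3.summable.mul_left _)]
  refine tsum_le_of_telescope h4
    (RapidOn.add (RapidOn.sub (RapidOn.weight (PolyBounded.const _) h1)
      (RapidOn.weight (PolyBounded.const _) h2)) (RapidOn.weight (PolyBounded.const _) h3))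
    (rapid_shift_terms hA hB hx hy) fun β => ?_
  have hSp := Sv_pos hα β
  have hip := inv_pos.mpr hSp
  have hn : 0 ≤ x β ^ 2 + y β ^ 2 := by positivity
  have comp := fun a b : ℝ => mul_weighted_sum_le (a := a) (b := b)
    (mul_inv_cancel₀ hSp.ne') hip.le (Sv_convex α β) (Sv_next_le α β) (Sv_le_next α β)
    (Sv_prev_le α β) (Sv_le_prev α β)
  have ex := comp (x (β - 1)) (x (β + 1))
  have ey := comp (y (β - 1)) (y (β + 1))
  have e1 : Sv α β * (mw α β)⁻¹ = Sv α β + (mw α β)⁻¹ := by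
    have f1 := (mw_pos hα β).ne'
    have f2 := Sv_mul_mw hα β
    field_simp
    linarith
  have e2 : -2 * (Sv α β * (mw α β)⁻¹)
      + (1 / 2 * (Sv α (β + 1 - 1) + Sv α (β + 1))
        + 1 / 4 * (Sv α (β + 1 + 1) + Sv α (β + 1 - 1) - 2 * Sv α (β + 1)) + (Sv α (β + 1))⁻¹)
      + (1 / 2 * (Sv α (β - 1 + 1) + Sv α (β - 1))
        + 1 / 4 * (Sv α (β - 1 + 1) + Sv α (β - 1 - 1) - 2 * Sv α (β - 1)) + (Sv α (β - 1))⁻¹)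
      ≤ -2 * (mw α β)⁻¹ + 6 * (Sv α β)⁻¹ := by
    have f1 := inv_Sv_next_le hα β
    have f2 := inv_Sv_prev_le hα β
    have f3 := Sv_second_difference_le hα β
    have f4 := Sv_second_difference_le hα (β + 1)
    have f5 := Sv_second_difference_le hα (β - 1)
    simp only [add_sub_cancel_right, sub_add_cancel] at f4 f5 ⊢
    rw [e1]
    linarith
  have e3 := mul_le_mul_of_nonneg_right e2 hn
  have e4 : mw α β = 1 - (Sv α β)⁻¹ := rfl
  unfold nbrSum halfDiff
  simp only [add_sub_cancel_right, sub_add_cancel] at e3 ⊢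
  rw [e4] at e3 ⊢
  linarith

/-- Interpolation of `E₁` between the two dissipation rates. -/
lemma two_mul_wEnergy_sq_le (hα : 1 < |α|) {a b : ℝ} (ha : 0 ≤ a) (hb : 0 ≤ b) (hx : Rapid x)
    (hy : Rapid y) :
    2 * (a * b) * wEnergy (fun β => (β : ℝ) * β * (mw α β)⁻¹) x y ≤
      a ^ 2 * wEnergy (fun β => Sv α β * (mw α β)⁻¹) x y
        + b ^ 2 * wEnergy (fun β => (β : ℝ) * β * (Sv α β * (mw α β)⁻¹)) x y := by
  have hc := PolyBounded.cast
  have hS := polyBounded_Sv α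
  have hi := polyBounded_inv_mw hα
  rw [← wEnergy_const_mul, ← wEnergy_const_mul, ← wEnergy_const_mul,
    ← wEnergy_add hx hy ((PolyBounded.const _).mul (hS.mul hi))
      ((PolyBounded.const _).mul ((hc.mul hc).mul (hS.mul hi)))]
  refine wEnergy_mono hx hy ((PolyBounded.const _).mul ((hc.mul hc).mul hi))
    (((PolyBounded.const _).mul (hS.mul hi)).add
      ((PolyBounded.const _).mul ((hc.mul hc).mul (hS.mul hi)))) fun β => ?_
  have hm := inv_pos.mpr (mw_pos hα β)
  have h1 := abs_index_le_Sv α β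
  have h2 : (β : ℝ) * β = |(β : ℝ)| * |(β : ℝ)| := (abs_mul_abs_self _).symm
  have h3 : 2 * (a * b) * ((β : ℝ) * β) ≤ (a ^ 2 + b ^ 2 * ((β : ℝ) * β)) * Sv α β := by
    rw [h2]
    have f0 := abs_nonneg (β : ℝ)
    calc 2 * (a * b) * (|(β : ℝ)| * |(β : ℝ)|) ≤ 2 * (a * b) * (|(β : ℝ)| * Sv α β) := by gcongr
      _ ≤ _ := by
        nlinarith [mul_nonneg (sq_nonneg (a - b * |(β : ℝ)|)) (Sv_nonneg α β)]
  have h4 := mul_le_mul_of_nonneg_right h3 hm.le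
  linarith

end CrossEstimates

/-! ### The mode system in real coordinates -/

lemma RapidlyDecaying.exists_bound {θ : ℝ → ℤ → ℂ} (h : RapidlyDecaying θ) {T : ℝ} (hT : 0 < T)
    (k : ℕ) : ∃ M : ℝ, ∀ t ∈ Set.Icc 0 T, ∀ β : ℤ, (1 + (β : ℝ) ^ 2) ^ k * ‖θ t β‖ ≤ M := by
  obtain ⟨M, hM⟩ := h (2 * k) T hT
  refine ⟨M + 1, fun t ht β => ?_⟩
  obtain ⟨hs, hle⟩ := hM t ht.1 ht.2
  have h1 := hs.le_tsum β fun γ _ => by positivity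
  have h2 : ((1 + (β : ℝ) ^ 2) ^ k * ‖θ t β‖) ^ 2 ≤ M := by
    refine le_trans (le_of_eq ?_) (h1.trans hle)
    rw [mul_pow, ← pow_mul, mul_comm k 2]
  nlinarith [sq_nonneg ((1 + (β : ℝ) ^ 2) ^ k * ‖θ t β‖ - 1)]

section Modes

variable {α ν : ℝ} {θ : ℝ → ℤ → ℂ}

lemma uth_eq (α : ℝ) (θ : ℝ → ℤ → ℂ) (t : ℝ) (β : ℤ) :
    uth α θ t β = ((mw α β : ℝ) : ℂ) * θ t β := by
  unfold uth mw; push_cast; rfl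

/-- Real part of the mode `u(t,β)`. -/
noncomputable def uRe (α : ℝ) (θ : ℝ → ℤ → ℂ) (t : ℝ) (β : ℤ) : ℝ := (uth α θ t β).re

/-- Imaginary part of the mode `u(t,β)`. -/
noncomputable def uIm (α : ℝ) (θ : ℝ → ℤ → ℂ) (t : ℝ) (β : ℤ) : ℝ := (uth α θ t β).im

/-- Half the transport coefficient `α e^{-νt}`. -/
noncomputable def transportCoeff (α ν t : ℝ) : ℝ := α * Real.exp (-(ν * t)) / 2

lemma norm_uth_le (hα : 1 < |α|) (t : ℝ) (β : ℤ) : ‖uth α θ t β‖ ≤ ‖θ t β‖ := by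
  rw [uth_eq, norm_mul, Complex.norm_real, Real.norm_of_nonneg (mw_pos hα β).le]
  exact mul_le_of_le_one_left (norm_nonneg _) (mw_le_one α β)

lemma rapidOn_uRe (hα : 1 < |α|) (h : RapidlyDecaying θ) {T : ℝ} (hT : 0 < T) :
    RapidOn (Set.Icc 0 T) (uRe α θ) := fun k => by
  obtain ⟨M, hM⟩ := h.exists_bound hT k
  refine ⟨M, fun t ht β => le_trans ?_ (hM t ht β)⟩
  gcongr
  exact (Complex.abs_re_le_norm _).trans (norm_uth_le hα t β)

lemma rapidOn_uIm (hα : 1 < |α|) (h : RapidlyDecaying θ) {T : ℝ} (hT : 0 < T) :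
    RapidOn (Set.Icc 0 T) (uIm α θ) := fun k => by
  obtain ⟨M, hM⟩ := h.exists_bound hT k
  refine ⟨M, fun t ht β => le_trans ?_ (hM t ht β)⟩
  gcongr
  exact (Complex.abs_im_le_norm _).trans (norm_uth_le hα t β)

lemma hasDerivWithinAt_uth (h : CriticalQG α ν θ) {t : ℝ} (ht : 0 ≤ t) (β : ℤ) :
    HasDerivWithinAt (fun τ => uth α θ τ β)
      (-((ν * Sv α β : ℝ) : ℂ) * uth α θ t β - Complex.I * ((transportCoeff α ν t : ℝ) : ℂ) *
        (((mw α β : ℝ) : ℂ) * (uth α θ t (β - 1) + uth α θ t (β + 1)))) (Set.Ici 0) t := by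
  have h1 := (h t ht β).const_mul ((mw α β : ℝ) : ℂ)
  simp only [uth_eq] at h1 ⊢
  refine h1.congr_deriv ?_
  unfold transportCoeff mw
  push_cast
  ring

lemma hasDerivWithinAt_uRe (h : CriticalQG α ν θ) {t : ℝ} (ht : 0 ≤ t) (β : ℤ) :
    HasDerivWithinAt (fun τ => uRe α θ τ β)
      (-(ν * Sv α β) * uRe α θ t β
        + transportCoeff α ν t * (mw α β * nbrSum (uIm α θ t) β)) (Set.Ici 0) t := by
  have h1 := Complex.reCLM.hasFDerivAt.comp_hasDerivWithinAt t (hasDerivWithinAt_uth h ht β)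
  refine h1.congr_deriv ?_
  simp only [uRe, uIm, nbrSum, Complex.reCLM_apply, Complex.sub_re, Complex.mul_re,
    Complex.neg_re, Complex.neg_im, Complex.ofReal_re, Complex.ofReal_im, Complex.I_re,
    Complex.I_im, Complex.mul_im, Complex.add_re, Complex.add_im]
  ring

lemma hasDerivWithinAt_uIm (h : CriticalQG α ν θ) {t : ℝ} (ht : 0 ≤ t) (β : ℤ) :
    HasDerivWithinAt (fun τ => uIm α θ τ β)
      (-(ν * Sv α β) * uIm α θ t β
        - transportCoeff α ν t * (mw α β * nbrSum (uRe α θ t) β)) (Set.Ici 0) t := by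
  have h1 := Complex.imCLM.hasFDerivAt.comp_hasDerivWithinAt t (hasDerivWithinAt_uth h ht β)
  refine h1.congr_deriv ?_
  simp only [uRe, uIm, nbrSum, Complex.imCLM_apply, Complex.sub_im, Complex.mul_re,
    Complex.neg_re, Complex.neg_im, Complex.ofReal_re, Complex.ofReal_im, Complex.I_re,
    Complex.I_im, Complex.mul_im, Complex.add_re, Complex.add_im]
  ring

lemma abs_transportCoeff_le (hν : 0 < ν) {t : ℝ} (ht : 0 ≤ t) :
    |transportCoeff α ν t| ≤ |α| / 2 := by
  unfold transportCoeff
  have h1 : Real.exp (-(ν * t)) ≤ 1 := Real.exp_le_one_iff.mpr (by nlinarith)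
  rw [abs_div, abs_mul, abs_of_pos (Real.exp_pos _), abs_of_pos (zero_lt_two : (0 : ℝ) < 2)]
  gcongr
  exact mul_le_of_le_one_right (abs_nonneg _) h1

lemma RapidOn.nbrSum {s : Set ℝ} {f : ℝ → ℤ → ℝ} (hf : RapidOn s f) :
    RapidOn s (fun t => nbrSum (f t)) := hf.prev.add hf.next

lemma RapidC1.nbrSum {s : Set ℝ} {f f' : ℝ → ℤ → ℝ} (hf : RapidC1 s f f') :
    RapidC1 s (fun t => nbrSum (f t)) (fun t => nbrSum (f' t)) := hf.prev.add hf.next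

lemma rapidC1_uRe (hα : 1 < |α|) (hν : 0 < ν) (hd : RapidlyDecaying θ) (h : CriticalQG α ν θ)
    {T : ℝ} (hT : 0 < T) :
    RapidC1 (Set.Icc 0 T) (uRe α θ) (fun t β => -(ν * Sv α β) * uRe α θ t β
      + transportCoeff α ν t * (mw α β * nbrSum (uIm α θ t) β)) where
  rapid := rapidOn_uRe hα hd hT
  rapid' := RapidOn.add
    ((rapidOn_uRe hα hd hT).weight ((PolyBounded.const ν).mul (polyBounded_Sv α)).neg)
    (((rapidOn_uIm hα hd hT).nbrSum.weight (polyBounded_mw hα)).mul_time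
      fun _ ht => abs_transportCoeff_le hν ht.1)
  deriv _ ht β := (hasDerivWithinAt_uRe h ht.1 β).mono Set.Icc_subset_Ici_self

lemma rapidC1_uIm (hα : 1 < |α|) (hν : 0 < ν) (hd : RapidlyDecaying θ) (h : CriticalQG α ν θ)
    {T : ℝ} (hT : 0 < T) :
    RapidC1 (Set.Icc 0 T) (uIm α θ) (fun t β => -(ν * Sv α β) * uIm α θ t β
      - transportCoeff α ν t * (mw α β * nbrSum (uRe α θ t) β)) where
  rapid := rapidOn_uIm hα hd hT
  rapid' := RapidOn.sub
    ((rapidOn_uIm hα hd hT).weight ((PolyBounded.const ν).mul (polyBounded_Sv α)).neg)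
    (((rapidOn_uRe hα hd hT).nbrSum.weight (polyBounded_mw hα)).mul_time
      fun _ ht => abs_transportCoeff_le hν ht.1)
  deriv _ ht β := (hasDerivWithinAt_uIm h ht.1 β).mono Set.Icc_subset_Ici_self

/-! ### The functionals in real coordinates -/

lemma weight_mul_norm_sq (hα : 1 < |α|) (t : ℝ) (β : ℤ) :
    (Sv α β - 1) / Sv α β * ‖θ t β‖ ^ 2 =
      (mw α β)⁻¹ * (uRe α θ t β ^ 2 + uIm α θ t β ^ 2) := by
  have h1 := (mw_pos hα β).ne'
  have h2 := (Sv_pos hα β).ne'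
  have h3 : (Sv α β - 1) / Sv α β = mw α β := by unfold mw; field_simp
  have h4 : uRe α θ t β ^ 2 + uIm α θ t β ^ 2 = mw α β ^ 2 * ‖θ t β‖ ^ 2 := by
    rw [← mul_pow, ← Real.norm_of_nonneg (mw_pos hα β).le, ← Complex.norm_real, ← norm_mul,
      ← uth_eq, Complex.sq_norm, Complex.normSq_apply]
    unfold uRe uIm; ring
  rw [h3, h4]
  field_simp

lemma E0_eq (hα : 1 < |α|) (t : ℝ) :
    E0 α θ t = wEnergy (fun β => (mw α β)⁻¹) (uRe α θ t) (uIm α θ t) :=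
  tsum_congr fun β => weight_mul_norm_sq hα t β

lemma E1_eq (hα : 1 < |α|) (t : ℝ) :
    E1 α θ t = wEnergy (fun β => (β : ℝ) * β * (mw α β)⁻¹) (uRe α θ t) (uIm α θ t) :=
  tsum_congr fun β => by rw [mul_assoc, weight_mul_norm_sq hα]; ring

lemma mE1_eq (t : ℝ) :
    mE1 α θ t = -(Real.sign α / 2) * crossSum (uRe α θ t) (uIm α θ t) := by
  unfold mE1 crossSum
  rw [← mul_assoc]
  congr 1
  · ring
  · refine tsum_congr fun β => ?_
    unfold wronsk uRe uIm
    simp only [Complex.mul_im, Complex.sub_re, Complex.sub_im, Complex.conj_re, Complex.conj_im,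
      add_sub_cancel_right]
    ring

lemma mE2_eq (hα : 1 < |α|) {t : ℝ} (hx : Rapid (uRe α θ t)) (hy : Rapid (uIm α θ t)) :
    mE2 α θ t = defectEnergy α (uRe α θ t) (uIm α θ t) := by
  have h1 := hx.energy (polyBounded_inv_mw hα) hy
  have h2 := hx.nbrSum.energy (polyBounded_mw hα) hy.nbrSum
  unfold mE2 defectEnergy
  rw [E0_eq hα, h1.summable.tsum_sub (h2.summable.mul_left _), tsum_mul_left]
  unfold wEnergy
  congr 2
  refine tsum_congr fun β => ?_
  have h3 : (Sv α β - 1) / Sv α β = mw α β := by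
    have := (Sv_pos hα β).ne'
    unfold mw; field_simp
  rw [h3, Complex.sq_norm, Complex.normSq_apply]
  unfold nbrSum uRe uIm
  simp only [Complex.add_re, Complex.add_im]
  ring

lemma hasDerivWithinAt_E0 (hα : 1 < |α|) (hν : 0 < ν) (hd : RapidlyDecaying θ)
    (h : CriticalQG α ν θ) {T t : ℝ} (hT : 0 < T) (ht : t ∈ Set.Icc 0 T) :
    HasDerivWithinAt (E0 α θ)
      (-2 * ν * wEnergy (fun β => Sv α β * (mw α β)⁻¹) (uRe α θ t) (uIm α θ t))
      (Set.Icc 0 T) t := by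
  have hx := rapidC1_uRe hα hν hd h hT
  have hy := rapidC1_uIm hα hν hd h hT
  have h1 := ((hx.sq.add hy.sq).weight (polyBounded_inv_mw hα)).hasDerivWithinAt_tsum
    (convex_Icc 0 T) ht
  have h2 := tsum_energy_rate ν (transportCoeff α ν t) hα (PolyBounded.const 1)
    (hx.rapid.at_time ht) (hy.rapid.at_time ht) (fun _ => rfl) (fun _ => rfl)
  simp only [one_mul] at h2
  rw [tsum_wronsk_sub_next (hx.rapid.at_time ht) (hy.rapid.at_time ht), mul_zero, add_zero] at h2
  rw [show E0 α θ = _ from funext fun τ => E0_eq hα τ, ← h2]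
  exact h1

lemma hasDerivWithinAt_E1 (hα : 1 < |α|) (hν : 0 < ν) (hd : RapidlyDecaying θ)
    (h : CriticalQG α ν θ) {T t : ℝ} (hT : 0 < T) (ht : t ∈ Set.Icc 0 T) :
    HasDerivWithinAt (E1 α θ)
      (-2 * ν * wEnergy (fun β => (β : ℝ) * β * (Sv α β * (mw α β)⁻¹)) (uRe α θ t) (uIm α θ t)
        + 2 * transportCoeff α ν t * crossSum (uRe α θ t) (uIm α θ t)) (Set.Icc 0 T) t := by
  have hx := rapidC1_uRe hα hν hd h hT
  have hy := rapidC1_uIm hα hν hd h hT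
  have hb := PolyBounded.cast
  have h1 := ((hx.sq.add hy.sq).weight
    ((hb.mul hb).mul (polyBounded_inv_mw hα))).hasDerivWithinAt_tsum (convex_Icc 0 T) ht
  have h2 := tsum_energy_rate ν (transportCoeff α ν t) hα (hb.mul hb)
    (hx.rapid.at_time ht) (hy.rapid.at_time ht) (fun _ => rfl) (fun _ => rfl)
  rw [tsum_sq_mul_wronsk_sub_next (hx.rapid.at_time ht) (hy.rapid.at_time ht)] at h2
  rw [show E1 α θ = _ from funext fun τ => E1_eq hα τ, ← h2]
  exact h1

lemma hasDerivWithinAt_mE1 (hα : 1 < |α|) (hν : 0 < ν) (hd : RapidlyDecaying θ)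
    (h : CriticalQG α ν θ) {T t : ℝ} (hT : 0 < T) (ht : t ∈ Set.Icc 0 T) :
    HasDerivWithinAt (mE1 α θ)
      (-(Real.sign α / 2) * (-ν * crossDissipation α (uRe α θ t) (uIm α θ t)
        + 4 * transportCoeff α ν t * transportForm α (uRe α θ t) (uIm α θ t)))
      (Set.Icc 0 T) t := by
  have hx := rapidC1_uRe hα hν hd h hT
  have hy := rapidC1_uIm hα hν hd h hT
  have hw := (hy.prev.mul hx).sub (hx.prev.mul hy)
  have h1 := ((hw.add hw.next).weight PolyBounded.cast).hasDerivWithinAt_tsum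
    (convex_Icc 0 T) ht
  have h2 := tsum_crossSum_rate ν (transportCoeff α ν t) hα
    (hx.rapid.at_time ht) (hy.rapid.at_time ht) (fun _ => rfl) (fun _ => rfl)
  rw [show mE1 α θ = _ from funext fun τ => mE1_eq τ, ← h2]
  exact h1.const_mul _

lemma hasDerivWithinAt_mE2 (hα : 1 < |α|) (hν : 0 < ν) (hd : RapidlyDecaying θ)
    (h : CriticalQG α ν θ) {T t : ℝ} (hT : 0 < T) (ht : t ∈ Set.Icc 0 T) :
    HasDerivWithinAt (mE2 α θ) (ν * defectDissipation α (uRe α θ t) (uIm α θ t))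
      (Set.Icc 0 T) t := by
  have hx := rapidC1_uRe hα hν hd h hT
  have hy := rapidC1_uIm hα hν hd h hT
  have h1 := (((hx.sq.add hy.sq).weight (polyBounded_inv_mw hα)).sub
    (((hx.nbrSum.sq.add hy.nbrSum.sq).weight (polyBounded_mw hα)).weight
      (PolyBounded.const (1 / 4)))).hasDerivWithinAt_tsum (convex_Icc 0 T) ht
  have h2 := tsum_defect_rate ν (transportCoeff α ν t) hα
    (hx.rapid.at_time ht) (hy.rapid.at_time ht) (fun _ => rfl) (fun _ => rfl)
  rw [← h2]
  exact h1.congr (fun τ hτ => mE2_eq hα (hx.rapid.at_time hτ) (hy.rapid.at_time hτ))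
    (mE2_eq hα (hx.rapid.at_time ht) (hy.rapid.at_time ht))

end Modes

/-! ### Choice of constants and the differential inequality -/

/-- Relations between the coefficients of the functional. Here `b² = a₁`, `r² = |α|`, `κ` is the
coercivity constant and `L` bounds the terms to be absorbed. -/
lemma coefficient_absorption {k K r κ L b a₂ a₃ : ℝ} (hκ : 0 < κ) (hr : 1 ≤ r)
    (hK : 1 ≤ K) (hKL : 6 * L ≤ κ * K) (hk0 : 0 < k) (hk : 24 ≤ κ * k)
    (hb : b = 1 / (2 * k * K * r)) (ha₂ : a₂ = 1 / (8 * k ^ 2 * K ^ 3 * r))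
    (ha₃ : a₃ = 1 / (8 * k ^ 2 * K ^ 4)) :
    2 * b ^ 3 * r ^ 4 + 9 * a₂ ^ 2 / (2 * b) + a₃ * r * L ≤ a₂ * r ^ 2 * (κ / 3) := by
  have hK0 : 0 < K := by linarith
  have hr0 : 0 < r := by linarith
  have h1 : 2 * b ^ 3 * r ^ 4 + 9 * a₂ ^ 2 / (2 * b) + a₃ * r * L =
      r / (k ^ 2 * K ^ 3) * (1 / (4 * k) + 9 / (64 * k * K ^ 2 * r ^ 2) + L / (8 * K)) := by
    rw [hb, ha₂, ha₃]
    field_simp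
    ring
  have h2 : a₂ * r ^ 2 * (κ / 3) = r / (k ^ 2 * K ^ 3) * (κ / 24) := by
    rw [ha₂]; field_simp; norm_num
  rw [h1, h2]
  refine mul_le_mul_of_nonneg_left ?_ (by positivity)
  have h3 : 9 / (64 * k * K ^ 2 * r ^ 2) ≤ 9 / (64 * k) := by
    refine div_le_div_of_nonneg_left (by norm_num) (by positivity) ?_
    have : 1 ≤ K ^ 2 * r ^ 2 := one_le_mul_of_one_le_of_one_le (one_le_pow₀ hK) (one_le_pow₀ hr)
    nlinarith
  have h4 : 1 / (4 * k) + 9 / (64 * k) ≤ κ / 48 := by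
    have : 1 / (4 * k) + 9 / (64 * k) = 25 / 64 / k := by field_simp; norm_num
    rw [this, div_le_iff₀ hk0]
    linarith
  have h5 : L / (8 * K) ≤ κ / 48 := by
    rw [div_le_iff₀ (by positivity)]
    linarith
  linarith

/-- The scalar inequality closing the hypocoercivity argument. -/
lemma decay_of_bounds {ν t e r κ L m₀ b a₂ a₃ D₀ D₁ E₀ E₁ G M N X Y Z Ξ q₁ q₂ R : ℝ}
    (hν : 0 < ν) (ht : 0 ≤ t) (hνt : ν * t ≤ 1) (hνt3 : ν ^ 2 * t ^ 3 ≤ 1)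
    (he : 1 / 3 ≤ e) (hr : 1 ≤ r) (hm₀ : 0 < m₀)
    (hb0 : 0 < b) (hb : b ≤ 1 / 2) (ha₂ : 0 < a₂) (ha₂' : a₂ ≤ 2 / 3) (ha₃ : 0 < a₃)
    (hcoef : 2 * b ^ 3 * r ^ 4 + 9 * a₂ ^ 2 / (2 * b) + a₃ * r * L ≤ a₂ * r ^ 2 * (κ / 3))
    (hκ : 0 < κ) (hL : L = 4 + (12 / m₀ + 6) * 40000)
    (hD₀ : 0 ≤ D₀) (hE₀ : 0 ≤ E₀) (hE₁ : 0 ≤ E₁) (hX : 0 ≤ X) (hY : 0 ≤ Y) (hZ : 0 ≤ Z)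
    (hΞ : 0 ≤ Ξ)
    (hinterp : 2 * (b * (ν * t)) * E₁ ≤ D₀ + (b * (ν * t)) ^ 2 * D₁)
    (hG : κ * (X + Y) ≤ G) (hZXY : Z ≤ 40000 * r * (X + Y)) (hM : M ≤ X + 3 / m₀ * Z)
    (hN : N ≤ -2 * E₀ - 2 * Ξ + 6 * Z)
    (hq₁ : q₁ ≤ b * t / 2 * E₁ + 2 * b ^ 3 * r ^ 4 * t ^ 3 * X)
    (hq₂ : q₂ ≤ b * t / 2 * E₁ + 9 * a₂ ^ 2 / (2 * b) * t ^ 3 * X)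
    (hR : R ≤ b ^ 2 * t ^ 2 * D₁ + 1 / 2 * a₃ * t ^ 4 * Ξ + 3 / 2 * a₂ * t ^ 3 * D₀) :
    -2 * ν * D₀ + b ^ 2 * ν ^ 2 * (2 * t * E₁) - 2 * b ^ 2 * ν ^ 3 * t ^ 2 * D₁
      + ν ^ 2 * q₁ + ν ^ 2 * q₂ - a₂ * ν ^ 2 * t ^ 3 * (r ^ 2 * e) * G + ν ^ 3 * R
      + a₃ * ν ^ 2 * (4 * t ^ 3 * M) + a₃ * ν ^ 3 * t ^ 4 * N ≤ -(a₃ * ν ^ 3 * t ^ 4 * E₀) := by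
  have hXY : 0 ≤ X + Y := by linarith
  have hMZ : 4 * M + 6 * Z ≤ r * L * (X + Y) := by
    have h1 : X ≤ r * (X + Y) := by nlinarith
    have h2 : (12 / m₀ + 6) * Z ≤ (12 / m₀ + 6) * (40000 * r * (X + Y)) :=
      mul_le_mul_of_nonneg_left hZXY (by positivity)
    have h3 : 12 / m₀ * Z = 4 * (3 / m₀ * Z) := by ring
    rw [hL]
    linarith
  have hbr : (2 * b ^ 3 * r ^ 4 + 9 * a₂ ^ 2 / (2 * b)) * X + a₃ * (4 * M)
      + a₃ * (ν * t) * (6 * Z) - a₂ * (r ^ 2 * e) * G ≤ 0 := by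
    have h1 : (2 * b ^ 3 * r ^ 4 + 9 * a₂ ^ 2 / (2 * b)) * X ≤
        (2 * b ^ 3 * r ^ 4 + 9 * a₂ ^ 2 / (2 * b)) * (X + Y) := by
      refine mul_le_mul_of_nonneg_left (by linarith) ?_
      positivity
    have h2 : a₃ * (ν * t) * (6 * Z) ≤ a₃ * 1 * (6 * Z) := by gcongr
    have h3 := mul_le_mul_of_nonneg_left hMZ ha₃.le
    have h4 : a₂ * r ^ 2 * (κ / 3) * (X + Y) ≤ a₂ * (r ^ 2 * e) * G := by
      calc a₂ * r ^ 2 * (κ / 3) * (X + Y) = a₂ * (r ^ 2 * (1 / 3)) * (κ * (X + Y)) := by ring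
        _ ≤ a₂ * (r ^ 2 * e) * G := by
          refine mul_le_mul (by gcongr) hG (by positivity) (by positivity)
    have h5 := mul_le_mul_of_nonneg_right hcoef hXY
    linarith
  have s1 := mul_le_mul_of_nonneg_left hbr (by positivity : 0 ≤ ν ^ 2 * t ^ 3)
  have s2 := mul_le_mul_of_nonneg_left hq₁ (sq_nonneg ν)
  have s3 := mul_le_mul_of_nonneg_left hq₂ (sq_nonneg ν)
  have s4 := mul_le_mul_of_nonneg_left hR (by positivity : 0 ≤ ν ^ 3)
  have s5 := mul_le_mul_of_nonneg_left hN (by positivity : 0 ≤ a₃ * ν ^ 3 * t ^ 4)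
  have s6 := mul_le_mul_of_nonneg_left hinterp hν.le
  have s7 : b ^ 2 * ν ^ 2 * (2 * t * E₁) ≤ b * ν ^ 2 * t * E₁ := by
    have : 0 ≤ (b * ν ^ 2 * t * E₁) * (1 - 2 * b) := mul_nonneg (by positivity) (by linarith)
    linarith
  have s8 : ν ^ 3 * (3 / 2 * a₂ * t ^ 3 * D₀) ≤ ν * D₀ := by
    calc ν ^ 3 * (3 / 2 * a₂ * t ^ 3 * D₀) = (3 / 2 * a₂) * (ν ^ 2 * t ^ 3) * (ν * D₀) := by ring
      _ ≤ 1 * 1 * (ν * D₀) := by gcongr; linarith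
      _ = _ := by ring
  have s9 : 0 ≤ a₃ * ν ^ 3 * t ^ 4 * Ξ := by positivity
  have s10 : 0 ≤ a₃ * ν ^ 3 * t ^ 4 * E₀ := by positivity
  linarith

lemma time_bounds {ν t : ℝ} (hν : 0 < ν) (hν1 : ν ≤ 1) (ht : 0 ≤ t)
    (htν : t ≤ ν ^ (-(3 / 5) : ℝ)) : ν * t ≤ 1 ∧ ν ^ 2 * t ^ 3 ≤ 1 := by
  set w := ν ^ (1 / 5 : ℝ) with hw
  have hw0 : 0 < w := Real.rpow_pos_of_pos hν _
  have hw1 : w ≤ 1 := Real.rpow_le_one hν.le hν1 (by norm_num)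
  have h5 : w ^ 5 = ν := by
    rw [hw, ← Real.rpow_natCast, ← Real.rpow_mul hν.le]; norm_num
  have h3 : ν ^ (-(3 / 5) : ℝ) = (w ^ 3)⁻¹ := by
    rw [Real.rpow_neg hν.le, hw, ← Real.rpow_natCast, ← Real.rpow_mul hν.le]; norm_num
  have hz : w ^ 3 * t ≤ 1 := by
    rw [h3] at htν
    calc w ^ 3 * t ≤ w ^ 3 * (w ^ 3)⁻¹ := by gcongr
      _ = 1 := mul_inv_cancel₀ (by positivity)
  have hz0 : 0 ≤ w ^ 3 * t := by positivity
  constructor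
  · calc ν * t = w ^ 2 * (w ^ 3 * t) := by rw [← h5]; ring
      _ ≤ 1 := mul_le_one₀ (pow_le_one₀ hw0.le hw1) hz0 hz
  · calc ν ^ 2 * t ^ 3 = w * (w ^ 3 * t) ^ 3 := by rw [← h5]; ring
      _ ≤ 1 := mul_le_one₀ hw1 (by positivity) (pow_le_one₀ hz0 hz)

lemma sign_sq {α : ℝ} (hα : α ≠ 0) : Real.sign α ^ 2 = 1 := by
  rcases lt_or_gt_of_ne hα with h | h
  · rw [Real.sign_of_neg h]; norm_num
  · rw [Real.sign_of_pos h]; norm_num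

lemma sign_mul_self_eq_abs (α : ℝ) : Real.sign α * α = |α| := by
  rcases lt_trichotomy α 0 with h | h | h
  · rw [Real.sign_of_neg h, abs_of_neg h]; ring
  · simp [h]
  · rw [Real.sign_of_pos h, abs_of_pos h]; ring

section Functional

variable {α ν : ℝ} {θ : ℝ → ℤ → ℂ}

lemma E0_le_PhiQG (hα : 1 < |α|) {t a₁ a₂ a₃ : ℝ} (ha₁ : 0 ≤ a₁) (ha₃ : 0 ≤ a₃)
    (ha : a₂ ^ 2 ≤ 4 * a₁ * a₃) (hx : Rapid (uRe α θ t)) (hy : Rapid (uIm α θ t)) :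
    E0 α θ t ≤ PhiQG a₁ a₂ a₃ α ν θ t := by
  have hα0 : α ≠ 0 := by rintro rfl; norm_num at hα
  have h1 := mul_crossSum_le (α := α) hα (c := a₂ * t ^ 3 * (Real.sign α / 2))
    (p := a₁ * t ^ 2 / 2) (q := a₃ * t ^ 4 / 2) (by positivity) (by positivity) (by
      calc (a₂ * t ^ 3 * (Real.sign α / 2)) ^ 2 = a₂ ^ 2 * t ^ 6 * Real.sign α ^ 2 / 4 := by ring
        _ = a₂ ^ 2 * t ^ 6 / 4 := by rw [sign_sq hα0]; ring
        _ ≤ 4 * a₁ * a₃ * t ^ 6 / 4 := by gcongr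
        _ = _ := by ring) hx hy
  have h2 := mul_le_mul_of_nonneg_left (le_defectEnergy hα hx hy)
    (by positivity : 0 ≤ a₃ * t ^ 4)
  unfold PhiQG
  rw [E1_eq hα, mE1_eq, mE2_eq hα hx hy]
  nlinarith [mul_le_mul_of_nonneg_left h1 (sq_nonneg ν),
    mul_le_mul_of_nonneg_left h2 (sq_nonneg ν)]

lemma hasDerivWithinAt_PhiQG (hα : 1 < |α|) (hν : 0 < ν) (hd : RapidlyDecaying θ)
    (h : CriticalQG α ν θ) {t : ℝ} (ht : 0 ≤ t) (a₁ a₂ a₃ : ℝ) :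
    HasDerivWithinAt (PhiQG a₁ a₂ a₃ α ν θ)
      (-2 * ν * wEnergy (fun β => Sv α β * (mw α β)⁻¹) (uRe α θ t) (uIm α θ t)
        + a₁ * ν ^ 2 * (2 * t * E1 α θ t + t ^ 2 *
          (-2 * ν * wEnergy (fun β => (β : ℝ) * β * (Sv α β * (mw α β)⁻¹)) (uRe α θ t) (uIm α θ t)
            + 2 * transportCoeff α ν t * crossSum (uRe α θ t) (uIm α θ t)))
        + a₂ * ν ^ 2 * (3 * t ^ 2 * mE1 α θ t + t ^ 3 *
          (-(Real.sign α / 2) * (-ν * crossDissipation α (uRe α θ t) (uIm α θ t)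
            + 4 * transportCoeff α ν t * transportForm α (uRe α θ t) (uIm α θ t))))
        + a₃ * ν ^ 2 * (4 * t ^ 3 * mE2 α θ t + t ^ 4 *
          (ν * defectDissipation α (uRe α θ t) (uIm α θ t)))) (Set.Ici 0) t := by
  have hT : 0 < t + 1 := by linarith
  have htT : t ∈ Set.Icc 0 (t + 1) := ⟨ht, by linarith⟩
  have h0 := hasDerivWithinAt_E0 hα hν hd h hT htT
  have h1 := hasDerivWithinAt_E1 hα hν hd h hT htT
  have h2 := hasDerivWithinAt_mE1 hα hν hd h hT htT
  have h3 := hasDerivWithinAt_mE2 hα hν hd h hT htT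
  have hp : ∀ n : ℕ, HasDerivWithinAt (fun τ : ℝ => τ ^ n) (n * t ^ (n - 1))
      (Set.Icc 0 (t + 1)) t := fun n => (hasDerivAt_pow n t).hasDerivWithinAt
  have key := ((h0.fun_add (((hp 2).const_mul (a₁ * ν ^ 2)).fun_mul h1)).fun_add
    (((hp 3).const_mul (a₂ * ν ^ 2)).fun_mul h2)).fun_add
    (((hp 4).const_mul (a₃ * ν ^ 2)).fun_mul h3)
  refine (key.congr_deriv ?_).mono_of_mem_nhdsWithin ?_
  · norm_num
    ring
  · rw [← Set.Ici_inter_Iic]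
    exact Filter.inter_mem self_mem_nhdsWithin
      (mem_nhdsWithin_of_mem_nhds (Iic_mem_nhds (by linarith)))

lemma PhiQG_rate_le (hα : 1 < |α|) (hν : 0 < ν) {t r m₀ κ L b a₂ a₃ : ℝ} (ht : 0 ≤ t)
    (hνt : ν * t ≤ 1) (hνt3 : ν ^ 2 * t ^ 3 ≤ 1) (hr1 : 1 ≤ r) (hr2 : r ^ 2 = |α|)
    (hm₀0 : 0 < m₀) (hm₀1 : m₀ ≤ 1) (hm : ∀ β, m₀ ≤ mw α β) (hb0 : 0 < b) (hb1 : b ≤ 1 / 2)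
    (ha₂0 : 0 < a₂) (ha₂1 : a₂ ≤ 2 / 3) (ha₃0 : 0 < a₃) (haaa : a₂ ^ 2 = b ^ 2 * a₃ / 2)
    (hκ : κ = m₀ / 8) (hL : L = 4 + (12 / m₀ + 6) * 40000)
    (hcoef : 2 * b ^ 3 * r ^ 4 + 9 * a₂ ^ 2 / (2 * b) + a₃ * r * L ≤ a₂ * r ^ 2 * (κ / 3))
    (hx : Rapid (uRe α θ t)) (hy : Rapid (uIm α θ t)) :
    -2 * ν * wEnergy (fun β => Sv α β * (mw α β)⁻¹) (uRe α θ t) (uIm α θ t)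
        + b ^ 2 * ν ^ 2 * (2 * t * E1 α θ t + t ^ 2 *
          (-2 * ν * wEnergy (fun β => (β : ℝ) * β * (Sv α β * (mw α β)⁻¹)) (uRe α θ t) (uIm α θ t)
            + 2 * transportCoeff α ν t * crossSum (uRe α θ t) (uIm α θ t)))
        + a₂ * ν ^ 2 * (3 * t ^ 2 * mE1 α θ t + t ^ 3 *
          (-(Real.sign α / 2) * (-ν * crossDissipation α (uRe α θ t) (uIm α θ t)
            + 4 * transportCoeff α ν t * transportForm α (uRe α θ t) (uIm α θ t))))
        + a₃ * ν ^ 2 * (4 * t ^ 3 * mE2 α θ t + t ^ 4 *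
          (ν * defectDissipation α (uRe α θ t) (uIm α θ t))) ≤
      -(a₃ * ν ^ 3 * t ^ 4 * E0 α θ t) := by
  have hα0 : α ≠ 0 := by rintro rfl; norm_num at hα
  have hr0 : 0 < r := by linarith
  have hκ0 : 0 < κ := by rw [hκ]; positivity
  obtain ⟨e, he⟩ : ∃ e : ℝ, e = Real.exp (-(ν * t)) := ⟨_, rfl⟩
  have he0 : 0 < e := he ▸ Real.exp_pos _
  have he1 : e ≤ 1 := he ▸ Real.exp_le_one_iff.mpr (by nlinarith)
  have he3 : 1 / 3 ≤ e := by
    have h1 : Real.exp (-1) ≤ e := he ▸ Real.exp_le_exp.mpr (by linarith)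
    have h2 : 1 / 3 ≤ Real.exp (-1) := by
      rw [Real.exp_neg, one_div]
      exact inv_anti₀ (Real.exp_pos _) (by linarith [Real.exp_one_lt_d9])
    linarith
  have hcoeff : transportCoeff α ν t = α * e / 2 := by rw [he]; rfl
  have hsα : Real.sign α * α = r ^ 2 := (sign_mul_self_eq_abs α).trans hr2.symm
  have hα2 : α ^ 2 = r ^ 4 := by rw [← sq_abs, ← hr2]; ring
  have hs2 := sign_sq hα0
  have hsabs : |Real.sign α| = 1 := by
    rw [← sq_eq_sq₀ (abs_nonneg _) zero_le_one, sq_abs, hs2, one_pow]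
  have hq₁ := mul_crossSum_le hα (c := b ^ 2 * t ^ 2 * (α * e)) (p := b * t / 4)
    (q := b ^ 3 * r ^ 4 * t ^ 3) (by positivity) (by positivity) (by
      calc (b ^ 2 * t ^ 2 * (α * e)) ^ 2 = b ^ 4 * t ^ 4 * r ^ 4 * e ^ 2 := by
            rw [← hα2]; ring
        _ ≤ b ^ 4 * t ^ 4 * r ^ 4 * 1 := by gcongr; exact pow_le_one₀ he0.le he1
        _ = _ := by ring) hx hy
  have hq₂ := mul_crossSum_le hα (c := a₂ * 3 * t ^ 2 * -(Real.sign α / 2)) (p := b * t / 4)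
    (q := 9 * a₂ ^ 2 / (4 * b) * t ^ 3) (by positivity) (by positivity) (by
      refine le_of_eq ?_
      calc (a₂ * 3 * t ^ 2 * -(Real.sign α / 2)) ^ 2
          = 9 * a₂ ^ 2 * t ^ 4 / 4 * Real.sign α ^ 2 := by ring
        _ = _ := by rw [hs2]; field_simp) hx hy
  have hR := mul_crossDissipation_le hα (c := a₂ * t ^ 3 * (Real.sign α / 2))
    (p := b ^ 2 * t ^ 2 / 4) (q := a₃ * t ^ 4 / 8) (by positivity) (by positivity) (by
      refine le_of_eq ?_
      calc (a₂ * t ^ 3 * (Real.sign α / 2)) ^ 2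
          = a₂ ^ 2 * t ^ 6 / 4 * Real.sign α ^ 2 := by ring
        _ = _ := by rw [hs2, haaa]; ring) hx hy
  have hcabs : |a₂ * t ^ 3 * (Real.sign α / 2)| = a₂ * t ^ 3 / 2 := by
    rw [abs_mul, abs_div, hsabs, abs_of_nonneg (by positivity : 0 ≤ a₂ * t ^ 3)]
    norm_num
    ring
  rw [hcabs] at hR
  have hinterp := two_mul_wEnergy_sq_le hα (a := 1) (b := b * (ν * t)) zero_le_one
    (by positivity) hx hy
  rw [one_mul, one_pow, one_mul] at hinterp
  have hS0 : ∀ β, 0 ≤ Sv α β := Sv_nonneg α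
  have hi0 : ∀ β, 0 ≤ (mw α β)⁻¹ := fun β => (inv_pos.mpr (mw_pos hα β)).le
  have key := decay_of_bounds (κ := κ) (L := L) (m₀ := m₀) hν ht hνt hνt3 he3 hr1 hm₀0 hb0 hb1
    ha₂0 ha₂1 ha₃0 hcoef hκ0 hL
    (wEnergy_nonneg fun β => mul_nonneg (hS0 β) (hi0 β)) (wEnergy_nonneg hi0)
    (wEnergy_nonneg fun β => mul_nonneg (mul_self_nonneg _) (hi0 β))
    (wEnergy_nonneg fun _ => zero_le_one)
    (wEnergy_nonneg fun β => mul_nonneg (sq_nonneg _) (pow_nonneg (inv_nonneg.mpr (hS0 β)) 3))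
    (wEnergy_nonneg fun β => inv_nonneg.mpr (hS0 β)) (wEnergy_nonneg hS0)
    hinterp (hκ ▸ transportForm_ge hα hm₀0 hm₀1 hm hx hy) (wEnergy_inv_Sv_le hα hr0 hr2 hx hy)
    (defectEnergy_le hα hm₀0 hm₀1 hm hx hy) (defectDissipation_le hα hx hy)
    (hq₁.trans_eq (by ring)) (hq₂.trans_eq (by ring)) (hR.trans_eq (by ring))
  rw [E0_eq hα, E1_eq hα, mE1_eq, mE2_eq hα hx hy, hcoeff]
  refine le_trans (le_of_eq ?_) key
  rw [← hsα]
  ring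

end Functional

theorem energy_functional_decay (c₀ : ℝ) (hc₀ : 1 < c₀) :
    ∃ c K : ℝ, 0 < c ∧ 0 < K ∧
      ∀ α : ℝ, c₀ ≤ |α| → ∀ a₁ a₂ a₃ : ℝ,
      a₁ = |α| ^ (-1 : ℝ) / (4 * c * K ^ 2) →
      a₂ = |α| ^ (-(1 / 2) : ℝ) / (8 * c * K ^ 3) →
      a₃ = 1 / (8 * c * K ^ 4) →
      ∀ ν : ℝ, 0 < ν → ν ≤ 1 →
      ∀ θ : ℝ → ℤ → ℂ, RapidlyDecaying θ → CriticalQG α ν θ →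
      ∀ t : ℝ, 0 ≤ t → t ≤ ν ^ (-(3 / 5) : ℝ) →
        E0 α θ t ≤ PhiQG a₁ a₂ a₃ α ν θ t ∧
        ∃ d : ℝ, HasDerivWithinAt (PhiQG a₁ a₂ a₃ α ν θ) d (Set.Ici 0) t ∧
          d ≤ -(a₃ * ν ^ 3 * t ^ 4 * E0 α θ t) := by
  obtain ⟨m₀, hm₀⟩ : ∃ m₀ : ℝ, m₀ = 1 - c₀⁻¹ := ⟨_, rfl⟩
  have hm₀0 : 0 < m₀ := by rw [hm₀, sub_pos]; exact inv_lt_one_of_one_lt₀ hc₀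
  have hm₀1 : m₀ ≤ 1 := by
    have : 0 < c₀⁻¹ := inv_pos.mpr (by linarith)
    rw [hm₀]; linarith
  obtain ⟨κ, hκ⟩ : ∃ κ : ℝ, κ = m₀ / 8 := ⟨_, rfl⟩
  have hκ0 : 0 < κ := by rw [hκ]; positivity
  obtain ⟨L, hL⟩ : ∃ L : ℝ, L = 4 + (12 / m₀ + 6) * 40000 := ⟨_, rfl⟩
  have hL0 : 0 < L := by rw [hL]; positivity
  obtain ⟨K, hK⟩ : ∃ K : ℝ, K = 1 + 6 * L / κ := ⟨_, rfl⟩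
  have hK1 : 1 ≤ K := by
    have : 0 ≤ 6 * L / κ := by positivity
    rw [hK]; linarith
  have hK0 : 0 < K := by linarith
  have hKL : 6 * L ≤ κ * K := by
    have : κ * K = κ + 6 * L := by rw [hK]; field_simp
    rw [this]; linarith
  obtain ⟨k, hk⟩ : ∃ k : ℝ, k = 24 / κ := ⟨_, rfl⟩
  have hk0 : 0 < k := by rw [hk]; positivity
  have hk24 : κ * k = 24 := by rw [hk]; field_simp
  have hk1 : 1 ≤ k := by
    have : κ ≤ 1 := by rw [hκ]; linarith
    nlinarith
  refine ⟨k ^ 2, K, by positivity, hK0, ?_⟩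
  intro α hαc a₁ a₂ a₃ ha₁ ha₂ ha₃ ν hν hν1 θ hd h t ht htν
  have hα : 1 < |α| := hc₀.trans_le hαc
  have hα0 : α ≠ 0 := by rintro rfl; norm_num at hα
  obtain ⟨r, hr⟩ : ∃ r : ℝ, r = √|α| := ⟨_, rfl⟩
  have hr2 : r ^ 2 = |α| := by rw [hr]; exact Real.sq_sqrt (abs_nonneg _)
  have hr1 : 1 ≤ r := by rw [hr]; exact Real.one_le_sqrt.mpr hα.le
  have hr0 : 0 < r := by linarith
  obtain ⟨b, hb⟩ : ∃ b : ℝ, b = 1 / (2 * k * K * r) := ⟨_, rfl⟩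
  have hb0 : 0 < b := by rw [hb]; positivity
  have hkKr : 1 ≤ k * K * r :=
    one_le_mul_of_one_le_of_one_le (one_le_mul_of_one_le_of_one_le hk1 hK1) hr1
  have hb1 : b ≤ 1 / 2 := by
    rw [hb]
    exact div_le_div_of_nonneg_left zero_le_one two_pos (by linarith)
  have ha₁' : a₁ = b ^ 2 := by
    rw [ha₁, hb, Real.rpow_neg_one, ← hr2]; field_simp; norm_num
  have ha₂' : a₂ = 1 / (8 * k ^ 2 * K ^ 3 * r) := by
    rw [ha₂, Real.rpow_neg (abs_nonneg _), ← Real.sqrt_eq_rpow, ← hr]; field_simp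
  have ha₂0 : 0 < a₂ := by rw [ha₂']; positivity
  have ha₃0 : 0 < a₃ := by rw [ha₃]; positivity
  have ha₂1 : a₂ ≤ 2 / 3 := by
    have h1 : 1 ≤ k ^ 2 * K ^ 3 * r := one_le_mul_of_one_le_of_one_le
      (one_le_mul_of_one_le_of_one_le (one_le_pow₀ hk1) (one_le_pow₀ hK1)) hr1
    rw [ha₂', div_le_iff₀ (by positivity)]
    linarith
  have haaa : a₂ ^ 2 = b ^ 2 * a₃ / 2 := by
    rw [ha₂', ha₃, hb]; field_simp; norm_num
  have hcoef := coefficient_absorption hκ0 hr1 hK1 hKL hk0 hk24.ge hb ha₂' ha₃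
  obtain ⟨hνt, hνt3⟩ := time_bounds hν hν1 ht htν
  have hmem : t ∈ Set.Icc 0 (t + 1) := ⟨ht, by linarith⟩
  have hx : Rapid (uRe α θ t) := (rapidOn_uRe hα hd (by linarith : 0 < t + 1)).at_time hmem
  have hy : Rapid (uIm α θ t) := (rapidOn_uIm hα hd (by linarith : 0 < t + 1)).at_time hmem
  subst ha₁'
  refine ⟨E0_le_PhiQG hα (by positivity) ha₃0.le
    (by rw [haaa]; nlinarith [mul_pos (pow_pos hb0 2) ha₃0]) hx hy, _,
    hasDerivWithinAt_PhiQG hα hν hd h ht _ _ _, ?_⟩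
  exact PhiQG_rate_le hα hν ht hνt hνt3 hr1 hr2 hm₀0 hm₀1
    (fun β => hm₀ ▸ le_mw hc₀ hαc β) hb0 hb1 ha₂0 ha₂1 ha₃0 haaa hκ hL hcoef hx hy
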